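/- (Key recursive h-inequality, first form.) Let P ∈ P(d,n,s) with ASP-pair (P,F), and let P' be the complex of all proper faces of P except F. Then for every k ≥ 0, (k+1)·h_{d−(k+1)}(P') ≤ (n−d+k)·h_{d−k}(P') + (n−d−s)·g_k(∂F), where ∂F denotes the boundary complex of the simplicial (d−1)-polytope F. -/

import Mathlib

open Finset

namespace ASP

noncomputable section

/-- The dot product of two vectors in `ℝ^d`. -/
def dotp {d : ℕ} (x y : Fin d → ℝ) : ℝ := ∑ i, x i * y i

/-- `F` is a face of the polytope `P ⊆ ℝ^d`: the intersection of `P` with a supporting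
hyperplane, together with the empty face and `P` itself. -/
def IsFaceOf {d : ℕ} (P F : Set (Fin d → ℝ)) : Prop :=
  F = ∅ ∨ F = P ∨
    ∃ (b : Fin d → ℝ) (c : ℝ), b ≠ 0 ∧ (∀ x ∈ P, dotp b x ≤ c) ∧
      F = {x ∈ P | dotp b x = c}

/-- The dimension of a subset of `ℝ^d`: the dimension of its affine span. -/
def polyDim {d : ℕ} (S : Set (Fin d → ℝ)) : ℕ :=
  Module.finrank ℝ (affineSpan ℝ S).direction

/-- A polytope: the convex hull of a finite point set. -/
def IsPolytope {d : ℕ} (P : Set (Fin d → ℝ)) : Prop :=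
  ∃ V : Finset (Fin d → ℝ), P = convexHull ℝ (V : Set (Fin d → ℝ))

/-- The vertex set of a polytope: its set of extreme points. -/
def verts {d : ℕ} (P : Set (Fin d → ℝ)) : Set (Fin d → ℝ) :=
  Set.extremePoints ℝ P

/-- `fVec P i` is the number of `i`-dimensional (nonempty) faces of `P`. -/
def fVec {d : ℕ} (P : Set (Fin d → ℝ)) (i : ℕ) : ℕ :=
  {F : Set (Fin d → ℝ) | IsFaceOf P F ∧ F.Nonempty ∧ polyDim F = i}.ncard

/-- A facet of a `d`-polytope in `ℝ^d`: a `(d-1)`-dimensional face. -/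
def IsFacetOf {d : ℕ} (P F : Set (Fin d → ℝ)) : Prop :=
  IsFaceOf P F ∧ F.Nonempty ∧ polyDim F = d - 1

/-- `(P, F)` is an ASP-pair: `P` is a `d`-polytope, `F` is a facet of `P`, and every facet
of `P` other than `F` is a simplex (i.e. has exactly `d` vertices). -/
def IsASPPair {d : ℕ} (P F : Set (Fin d → ℝ)) : Prop :=
  IsPolytope P ∧ polyDim P = d ∧ IsFacetOf P F ∧
    ∀ G, IsFacetOf P G → G ≠ F → (verts G).ncard = d

/-- `P ∈ 𝒫(d,n,s)`: `P` is a `d`-polytope with `n` vertices such that `(P,F)` is an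
ASP-pair where the facet `F` has `d + s` vertices. -/
def MemASP (d n s : ℕ) (P : Set (Fin d → ℝ)) : Prop :=
  (verts P).ncard = n ∧ ∃ F, IsASPPair P F ∧ (verts F).ncard = d + s

/-- `fBall P i` is `f_{i-1}(P')` of the simplicial ball `P' = ∂P - {F}` consisting of all
proper faces of `P` except its (unique non-simplex) facet `F`; the index is shifted by one,
so `fBall P 0 = f_{-1} = 1` counts the empty face, and at the top dimension the facet `F`
is discarded. -/
def fBall {d : ℕ} (P : Set (Fin d → ℝ)) (i : ℕ) : ℤ :=
  if i = 0 then 1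
  else if i = d then (fVec P (d - 1) : ℤ) - 1
  else if d < i then 0
  else (fVec P (i - 1) : ℤ)

/-- `hBall P k` is `h_k(P')` of the `(d-1)`-dimensional ball `P' = ∂P - {F}`, defined by
`h_k = ∑_{i=0}^{k} (-1)^{k-i} C(d-i, k-i) f_{i-1}(P')`, extended by `0` outside `0 ≤ k ≤ d`. -/
def hBall {d : ℕ} (P : Set (Fin d → ℝ)) (k : ℤ) : ℤ :=
  if 0 ≤ k ∧ k ≤ (d : ℤ) then
    ∑ i ∈ Finset.range (k.toNat + 1),
      (-1) ^ (k.toNat - i) * ((d - i).choose (k.toNat - i) : ℤ) * fBall P i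
  else 0

/-- `fBd m Q i` is `f_{i-1}(∂Q)` of the boundary complex of an `m`-polytope `Q ⊆ ℝ^d`
(a complex of dimension `m - 1`); the index is shifted by one. -/
def fBd {d : ℕ} (m : ℕ) (Q : Set (Fin d → ℝ)) (i : ℕ) : ℤ :=
  if i = 0 then 1 else if m + 1 ≤ i then 0 else (fVec Q (i - 1) : ℤ)

/-- `hBd m Q k` is `h_k(∂Q)` for the boundary complex of an `m`-polytope `Q ⊆ ℝ^d`, defined by
`h_k = ∑_{i=0}^{k} (-1)^{k-i} C(m-i, k-i) f_{i-1}(∂Q)`, extended by `0` outside `0 ≤ k ≤ m`. -/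
def hBd {d : ℕ} (m : ℕ) (Q : Set (Fin d → ℝ)) (k : ℤ) : ℤ :=
  if 0 ≤ k ∧ k ≤ (m : ℤ) then
    ∑ i ∈ Finset.range (k.toNat + 1),
      (-1) ^ (k.toNat - i) * ((m - i).choose (k.toNat - i) : ℤ) * fBd m Q i
  else 0

/-- `gBd m Q k = g_k(∂Q) = h_k(∂Q) - h_{k-1}(∂Q)`. -/
def gBd {d : ℕ} (m : ℕ) (Q : Set (Fin d → ℝ)) (k : ℤ) : ℤ :=
  hBd m Q k - hBd m Q (k - 1)

/-- The function `p(t) = (n-1)^{(t-1)(d-1)} · t(t+1)⋯(t+d+s-1)` (real exponentiation of the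
positive base `n-1`) used to define the almost cyclic polytope. -/
def acp (d n s : ℕ) (t : ℝ) : ℝ :=
  ((n : ℝ) - 1) ^ ((t - 1) * ((d : ℝ) - 1)) * ∏ l ∈ Finset.range (d + s), (t + l)

/-- The curve `y(t) = (t, t², …, t^{d-1}, p(t)) ∈ ℝ^d`. -/
def acy (d n s : ℕ) (t : ℝ) : Fin d → ℝ :=
  fun i => if (i : ℕ) + 1 = d then acp d n s t else t ^ ((i : ℕ) + 1)

/-- The parameter values `t_i = -s - d + i` for `i = 1, …, n` (here `0`-indexed:
`acT d s j = t_{j+1}`). -/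
def acT (d s j : ℕ) : ℝ := (j : ℝ) + 1 - s - d

/-- The `n` points `y(t_1), …, y(t_n)` on the curve `y` (`0`-indexed). -/
def acPoint (d n s : ℕ) (j : Fin n) : Fin d → ℝ := acy d n s (acT d s (j : ℕ))

/-- The almost cyclic polytope `C(d,n,s) = conv{y(t_1), …, y(t_n)}`. -/
def acPolytope (d n s : ℕ) : Set (Fin d → ℝ) :=
  convexHull ℝ (Set.range (acPoint d n s))

/-- The non-simplex facet `F = conv{y(t_1), …, y(t_{d+s})}` of the almost cyclic polytope. -/
def acFacet (d n s : ℕ) : Set (Fin d → ℝ) :=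
  convexHull ℝ (acPoint d n s '' {j : Fin n | (j : ℕ) < d + s})

/-- The generalized moment curve
`x(t) = (t, t², …, t^{d-r}, p_1(t), …, p_r(t)) ∈ ℝ^d`. -/
def gmc (d r : ℕ) (p : Fin r → ℝ → ℝ) (t : ℝ) : Fin d → ℝ :=
  fun i =>
    if h : (i : ℕ) < d - r then t ^ ((i : ℕ) + 1)
    else p ⟨(i : ℕ) - (d - r), by have h2 := i.2; omega⟩ t

/-- A polytope is `k`-neighborly if each subset of at most `k` of its vertices is the
vertex set of a face. -/
def IsNeighborly {d : ℕ} (k : ℕ) (P : Set (Fin d → ℝ)) : Prop :=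
  ∀ S : Finset (Fin d → ℝ), (S : Set (Fin d → ℝ)) ⊆ verts P → S.card ≤ k →
    ∃ G : Set (Fin d → ℝ), IsFaceOf P G ∧ verts G = (S : Set (Fin d → ℝ))

/-- The point `y` is beyond the facet `F` of the polytope `P`: for every supporting
hyperplane of `P` cutting out a facet, `y` is strictly on the outer side if the facet is `F`,
and strictly on the inner side otherwise. -/
def IsBeyond {d : ℕ} (P F : Set (Fin d → ℝ)) (y : Fin d → ℝ) : Prop :=
  ∀ (b : Fin d → ℝ) (c : ℝ), b ≠ 0 → (∀ x ∈ P, dotp b x ≤ c) →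
    IsFacetOf P {x ∈ P | dotp b x = c} →
      (({x ∈ P | dotp b x = c} = F → c < dotp b y) ∧
       ({x ∈ P | dotp b x = c} ≠ F → dotp b y < c))

def hOf (d : ℕ) (f : ℕ → ℤ) (k : ℕ) : ℤ :=
  ∑ i ∈ Finset.range (k + 1), (-1) ^ (k - i) * ((d - i).choose (k - i) : ℤ) * f i

theorem hOf_choose (d r k : ℕ) (hr : r ≤ d) (hk : k ≤ d) :
    hOf d (fun i => if r ≤ i then ((d - r).choose (i - r) : ℤ) else 0) k
      = if r = k then 1 else 0 := by
  unfold hOf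
  by_cases hkr : k < r
  · rw [if_neg (by omega)]
    apply Finset.sum_eq_zero
    intro i hi
    rw [Finset.mem_range] at hi
    beta_reduce
    rw [if_neg (by omega), mul_zero]
  · obtain ⟨m, rfl⟩ : ∃ m, k = r + m := ⟨k - r, by omega⟩
    rw [show r + m + 1 = r + (m + 1) by ring, Finset.sum_range_add]
    rw [Finset.sum_eq_zero, zero_add]
    swap
    · intro i hi
      rw [Finset.mem_range] at hi
      beta_reduce
      rw [if_neg (by omega), mul_zero]
    have h1 : ∀ j ∈ Finset.range (m + 1),
        (-1 : ℤ) ^ (r + m - (r + j)) * ((d - (r + j)).choose (r + m - (r + j)) : ℤ) *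
          (if r ≤ r + j then ((d - r).choose (r + j - r) : ℤ) else 0)
        = ((d - r).choose m : ℤ) * (1 ^ j * (-1 : ℤ) ^ (m - j) * (m.choose j : ℤ)) := by
      intro j hj
      rw [Finset.mem_range] at hj
      rw [if_pos (by omega)]
      have h2 := Nat.choose_mul (n := d - r) (k := m) (s := j) (by omega)
      rw [show r + m - (r + j) = m - j by omega, show d - (r + j) = d - r - j by omega,
        show r + j - r = j by omega]
      have h3 : ((d - r).choose m : ℤ) * (m.choose j : ℤ)
        = ((d - r).choose j : ℤ) * ((d - r - j).choose (m - j) : ℤ) := by exact_mod_cast h2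
      rw [one_pow]
      linear_combination (-1 : ℤ) ^ (m - j) * (-h3)
    rw [Finset.sum_congr rfl h1, ← Finset.mul_sum, ← add_pow]
    by_cases hm : m = 0
    · subst hm; simp
    · simp [hm]

section comb

variable {ι : Type*} [DecidableEq ι]

structure Part (𝓕 : Finset (Finset ι)) (R : Finset ι → Finset ι) (𝓢 : Finset (Finset ι)) :
    Prop where
  sub : ∀ G ∈ 𝓕, R G ⊆ G
  ex : ∀ σ ∈ 𝓢, ∃ G ∈ 𝓕, R G ⊆ σ ∧ σ ⊆ G
  mem : ∀ G ∈ 𝓕, ∀ σ, R G ⊆ σ → σ ⊆ G → σ ∈ 𝓢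
  uniq : ∀ G ∈ 𝓕, ∀ G' ∈ 𝓕, ∀ σ, R G ⊆ σ → σ ⊆ G → R G' ⊆ σ → σ ⊆ G' → G = G'

theorem card_interval (R G : Finset ι) (h : R ⊆ G) (i : ℕ) :
    (((Finset.Icc R G).filter (fun σ => σ.card = i)).card : ℤ)
      = if R.card ≤ i then ((G.card - R.card).choose (i - R.card) : ℤ) else 0 := by
  split_ifs with hi
  · have : (Finset.Icc R G).filter (fun σ => σ.card = i)
        = (Finset.powersetCard (i - R.card) (G \ R)).image (fun τ => R ∪ τ) := by
      ext σ
      simp only [mem_filter, Finset.mem_Icc, mem_image, mem_powersetCard]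
      constructor
      · rintro ⟨⟨h1, h2⟩, h3⟩
        refine ⟨σ \ R, ⟨sdiff_subset_sdiff h2 le_rfl, ?_⟩, ?_⟩
        · rw [card_sdiff_of_subset h1, h3]
        · exact union_sdiff_of_subset h1
      · rintro ⟨τ, ⟨h1, h2⟩, rfl⟩
        refine ⟨⟨subset_union_left, union_subset h (h1.trans sdiff_subset)⟩, ?_⟩
        rw [card_union_of_disjoint, h2]
        · omega
        · exact disjoint_of_subset_right h1 disjoint_sdiff
    rw [this, card_image_of_injOn, card_powersetCard, card_sdiff_of_subset h]
    intro a ha b hb hab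
    simp only [mem_coe, mem_powersetCard] at ha hb
    have e : ∀ τ, τ ⊆ G \ R → (R ∪ τ) \ R = τ := by
      intro τ hτ
      rw [union_sdiff_left]
      exact sdiff_eq_self_of_disjoint (disjoint_of_subset_left hτ sdiff_disjoint)
    have := congrArg (· \ R) hab
    simpa [e a ha.1, e b hb.1] using this
  · norm_cast
    rw [card_eq_zero, filter_eq_empty_iff]
    intro σ hσ h3
    rw [Finset.mem_Icc] at hσ
    have := card_le_card hσ.1
    omega

theorem Part.f_eq {𝓕 : Finset (Finset ι)} {R : Finset ι → Finset ι} {𝓢 : Finset (Finset ι)}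
    (h : Part 𝓕 R 𝓢) (d : ℕ) (hd : ∀ G ∈ 𝓕, G.card = d) (i : ℕ) :
    ((𝓢.filter (fun σ => σ.card = i)).card : ℤ)
      = ∑ G ∈ 𝓕, if (R G).card ≤ i then ((d - (R G).card).choose (i - (R G).card) : ℤ) else 0 := by
  have e : 𝓢.filter (fun σ => σ.card = i)
      = 𝓕.biUnion (fun G => (Finset.Icc (R G) G).filter (fun σ => σ.card = i)) := by
    ext σ
    simp only [mem_filter, mem_biUnion, Finset.mem_Icc]
    constructor
    · rintro ⟨h1, h2⟩
      obtain ⟨G, hG, h3⟩ := h.ex σ h1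
      exact ⟨G, hG, h3, h2⟩
    · rintro ⟨G, hG, h3, h2⟩
      exact ⟨h.mem G hG σ h3.1 h3.2, h2⟩
  rw [e, card_biUnion]
  · push_cast
    apply sum_congr rfl
    intro G hG
    rw [card_interval _ _ (h.sub G hG), hd G hG]
  · intro G hG G' hG' hne
    refine disjoint_left.2 ?_
    intro σ h1 h2
    simp only [mem_filter, Finset.mem_Icc] at h1 h2
    exact hne (h.uniq G hG G' hG' σ h1.1.1 h1.1.2 h2.1.1 h2.1.2)

theorem hOf_congr (d k : ℕ) (f g : ℕ → ℤ) (h : ∀ i ≤ k, f i = g i) : hOf d f k = hOf d g k := by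
  unfold hOf
  apply sum_congr rfl
  intro i hi
  rw [h i (by rw [Finset.mem_range] at hi; omega)]

theorem Part.h_eq {𝓕 : Finset (Finset ι)} {R : Finset ι → Finset ι} {𝓢 : Finset (Finset ι)}
    (h : Part 𝓕 R 𝓢) (d : ℕ) (hd : ∀ G ∈ 𝓕, G.card = d) (k : ℕ) (hk : k ≤ d) :
    hOf d (fun i => ((𝓢.filter (fun σ => σ.card = i)).card : ℤ)) k
      = ((𝓕.filter (fun G => (R G).card = k)).card : ℤ) := by
  rw [hOf_congr d k _ _ (fun i _ => h.f_eq d hd i)]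
  have : hOf d (fun i => ∑ G ∈ 𝓕, if (R G).card ≤ i then
      ((d - (R G).card).choose (i - (R G).card) : ℤ) else 0) k
      = ∑ G ∈ 𝓕, hOf d (fun i => if (R G).card ≤ i then
      ((d - (R G).card).choose (i - (R G).card) : ℤ) else 0) k := by
    unfold hOf
    rw [sum_comm]
    apply sum_congr rfl
    intro i _
    rw [mul_sum]
  rw [this]
  rw [card_filter]
  push_cast
  apply sum_congr rfl
  intro G hG
  apply hOf_choose _ _ _ _ hk
  rw [← hd G hG]
  exact card_le_card (h.sub G hG)

theorem Part.star {𝓕 : Finset (Finset ι)} {R : Finset ι → Finset ι} {𝓢 : Finset (Finset ι)}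
    (h : Part 𝓕 R 𝓢) (v : ι) :
    Part (𝓕.filter (fun G => v ∈ G)) (fun G => insert v (R G)) (𝓢.filter (fun σ => v ∈ σ)) where
  sub := by
    intro G hG
    rw [mem_filter] at hG
    exact insert_subset hG.2 (h.sub G hG.1)
  ex := by
    intro σ hσ
    rw [mem_filter] at hσ
    obtain ⟨G, hG, h1, h2⟩ := h.ex σ hσ.1
    exact ⟨G, mem_filter.2 ⟨hG, h2 hσ.2⟩, insert_subset hσ.2 h1, h2⟩
  mem := by
    intro G hG σ h1 h2
    rw [insert_subset_iff] at h1
    exact mem_filter.2 ⟨h.mem G (mem_filter.1 hG).1 σ h1.2 h2, h1.1⟩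
  uniq := by
    intro G hG G' hG' σ h1 h2 h3 h4
    rw [insert_subset_iff] at h1 h3
    exact h.uniq G (mem_filter.1 hG).1 G' (mem_filter.1 hG').1 σ h1.2 h2 h3.2 h4

theorem star_bound {𝓕 : Finset (Finset ι)} {R R' : Finset ι → Finset ι}
    {𝓢 𝓢' : Finset (Finset ι)} (h : Part 𝓕 R 𝓢) (h' : Part 𝓕 R' 𝓢')
    (d : ℕ) (hd : ∀ G ∈ 𝓕, G.card = d) (v : ι)
    (hs : 𝓢.filter (fun σ => v ∈ σ) = 𝓢'.filter (fun σ => v ∈ σ))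
    (hv : ∀ G ∈ 𝓕, v ∈ G → v ∉ R' G) (k : ℕ) (hkd : k ≤ d) :
    (((𝓕.filter (fun G => v ∈ G)).filter (fun G => (insert v (R G)).card = k + 1)).card : ℤ)
      ≤ hOf d (fun i => ((𝓢'.filter (fun σ => σ.card = i)).card : ℤ)) k := by
  have hd' : ∀ G ∈ 𝓕.filter (fun G => v ∈ G), G.card = d :=
    fun G hG => hd G (mem_filter.1 hG).1
  by_cases hk : k + 1 ≤ d
  swap
  · rw [h'.h_eq d hd k hkd, card_eq_zero.2]
    · positivity
    · rw [filter_eq_empty_iff]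
      intro G hG h2
      have h1 := card_le_card ((h.star v).sub G hG)
      rw [hd' G hG] at h1
      omega
  rw [← (h.star v).h_eq d hd' (k + 1) hk, hs, (h'.star v).h_eq d hd' (k + 1) hk,
    h'.h_eq d hd k (by omega)]
  norm_cast
  apply card_le_card
  intro G hG
  simp only [mem_filter] at hG ⊢
  refine ⟨hG.1.1, ?_⟩
  have := hG.2
  rw [card_insert_of_notMem (hv G hG.1.1 hG.1.2)] at this
  omega

theorem sum_star (V : Finset ι) (𝓕 : Finset (Finset ι)) (R : Finset ι → Finset ι) (d : ℕ)
    (hd : ∀ G ∈ 𝓕, G.card = d) (hV : ∀ G ∈ 𝓕, G ⊆ V) (hR : ∀ G ∈ 𝓕, R G ⊆ G) (k : ℕ) :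
    (∑ v ∈ V, (((𝓕.filter (fun G => v ∈ G)).filter
      (fun G => (insert v (R G)).card = k + 1)).card : ℤ))
    = (k + 1) * ((𝓕.filter (fun G => (R G).card = k + 1)).card : ℤ)
      + ((d : ℤ) - k) * ((𝓕.filter (fun G => (R G).card = k)).card : ℤ) := by
  have e1 : ∀ v ∈ V, (((𝓕.filter (fun G => v ∈ G)).filter
      (fun G => (insert v (R G)).card = k + 1)).card : ℤ)
      = ∑ G ∈ 𝓕, if v ∈ G ∧ (insert v (R G)).card = k + 1 then (1 : ℤ) else 0 := by
    intro v _
    rw [filter_filter, card_filter]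
    push_cast
    rfl
  rw [sum_congr rfl e1, sum_comm, card_filter, card_filter]
  push_cast
  rw [mul_sum, mul_sum, ← sum_add_distrib]
  apply sum_congr rfl
  intro G hG
  have e2 : (∑ v ∈ V, if v ∈ G ∧ (insert v (R G)).card = k + 1 then (1 : ℤ) else 0)
      = (((G.filter (fun v => (insert v (R G)).card = k + 1)).card : ℕ) : ℤ) := by
    rw [card_filter]
    push_cast
    rw [← sum_subset (hV G hG)]
    · apply sum_congr rfl
      intro v hv
      simp [hv]
    · intro v _ hv
      simp [hv]
  rw [e2]
  by_cases h1 : (R G).card = k + 1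
  · have : G.filter (fun v => (insert v (R G)).card = k + 1) = R G := by
      ext v
      rw [mem_filter]
      constructor
      · rintro ⟨_, h3⟩
        by_contra h4
        rw [card_insert_of_notMem h4] at h3
        omega
      · intro h3
        exact ⟨hR G hG h3, by rw [insert_eq_of_mem h3, h1]⟩
    rw [this, h1]
    simp
  · by_cases h2 : (R G).card = k
    · have : G.filter (fun v => (insert v (R G)).card = k + 1) = G \ R G := by
        ext v
        rw [mem_filter, mem_sdiff]
        constructor
        · rintro ⟨h5, h3⟩
          refine ⟨h5, fun h4 => ?_⟩
          rw [insert_eq_of_mem h4] at h3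
          omega
        · intro h3
          exact ⟨h3.1, by rw [card_insert_of_notMem h3.2, h2]⟩
      rw [this, card_sdiff_of_subset (hR G hG), hd G hG, h2]
      have := card_le_card (hR G hG)
      rw [hd G hG, h2] at this
      push_cast [this]
      simp
    · have : G.filter (fun v => (insert v (R G)).card = k + 1) = ∅ := by
        rw [filter_eq_empty_iff]
        intro v _ h3
        by_cases h4 : v ∈ R G
        · rw [insert_eq_of_mem h4] at h3
          omega
        · rw [card_insert_of_notMem h4] at h3
          omega
      rw [this]
      simp [h1, h2]

theorem comb_main (V VF : Finset ι) (𝓕 : Finset (Finset ι)) (d : ℕ) (hVF : VF ⊆ V)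
    (hne : VF.Nonempty)
    (hd : ∀ G ∈ 𝓕, G.card = d) (hV : ∀ G ∈ 𝓕, G ⊆ V)
    (𝓟 : Finset (Finset ι))
    (hA : ∀ v ∈ VF, ∃ R, Part 𝓕 R (𝓟.filter (fun σ => ¬ σ ⊆ VF)) ∧
      Part 𝓕 (fun G => G \ R G) 𝓟 ∧ ∀ G ∈ 𝓕, v ∈ G → v ∉ R G)
    (hB : ∀ v ∈ V, v ∉ VF → ∃ R, Part 𝓕 R 𝓟 ∧ ∀ G ∈ 𝓕, v ∈ G → v ∉ R G)
    (f fb : ℕ → ℤ)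
    (hf : ∀ i, f i = ((𝓟.filter (fun σ => σ.card = i)).card : ℤ))
    (hfb : ∀ i, fb i = ((𝓟.filter (fun σ => σ ⊆ VF ∧ σ.card = i)).card : ℤ))
    (k : ℕ) (hk : k ≤ d) :
    ((k : ℤ) + 1) * (if k + 1 ≤ d then hOf d f (d - (k + 1)) else 0)
      ≤ ((V.card : ℤ) - d + k) * hOf d f (d - k)
        + ((V.card : ℤ) - VF.card) * hOf d fb k := by
  obtain ⟨v0, hv0⟩ := hne
  obtain ⟨R, hR, hRc, -⟩ := hA v0 hv0
  obtain rfl : f = fun i => ((𝓟.filter (fun σ => σ.card = i)).card : ℤ) := funext hf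
  obtain rfl : fb = fun i => ((𝓟.filter (fun σ => σ ⊆ VF ∧ σ.card = i)).card : ℤ) := funext hfb
  set f : ℕ → ℤ := fun i => ((𝓟.filter (fun σ => σ.card = i)).card : ℤ)
  set fb : ℕ → ℤ := fun i => ((𝓟.filter (fun σ => σ ⊆ VF ∧ σ.card = i)).card : ℤ)
  set 𝓡 := 𝓟.filter (fun σ => ¬ σ ⊆ VF) with h𝓡
  set fr : ℕ → ℤ := fun i => ((𝓡.filter (fun σ => σ.card = i)).card : ℤ)
  have hfr : ∀ i, f i = fb i + fr i := by
    intro i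
    simp only [f, fb, fr]
    norm_cast
    rw [h𝓡, filter_filter]
    rw [← card_union_of_disjoint]
    · congr 1
      ext σ
      simp only [mem_filter, mem_union]
      tauto
    · rw [disjoint_left]
      intro σ
      simp only [mem_filter]
      tauto
  have hsum : hOf d f k = hOf d fb k + hOf d fr k := by
    unfold hOf
    rw [← sum_add_distrib]
    apply sum_congr rfl
    intro i _
    rw [hfr]
    ring
  -- complement
  have hcomp : ∀ j ≤ d, hOf d f (d - j) = ((𝓕.filter (fun G => (R G).card = j)).card : ℤ) := by
    intro j hj
    rw [hRc.h_eq d hd (d - j) (by omega)]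
    norm_cast
    congr 1
    apply filter_congr
    intro G hG
    have h1 := card_le_card (hR.sub G hG)
    rw [card_sdiff_of_subset (hR.sub G hG), hd G hG]
    rw [hd G hG] at h1
    omega
  have hfrk : hOf d fr k = hOf d f (d - k) := by
    rw [hcomp k hk, hR.h_eq d hd k hk]
  have hfirst : (if k + 1 ≤ d then hOf d f (d - (k + 1)) else 0)
      = ((𝓕.filter (fun G => (R G).card = k + 1)).card : ℤ) := by
    split_ifs with h
    · exact hcomp _ h
    · symm
      norm_cast
      rw [card_eq_zero, filter_eq_empty_iff]
      intro G hG h2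
      have h1 := card_le_card (hR.sub G hG)
      rw [hd G hG] at h1
      omega
  have hs := sum_star V 𝓕 R d hd hV hR.sub k
  rw [hfirst, hcomp k hk]
  rw [hcomp k hk] at hfrk
  suffices hle : (∑ v ∈ V, (((𝓕.filter (fun G => v ∈ G)).filter
      (fun G => (insert v (R G)).card = k + 1)).card : ℤ))
      ≤ (VF.card : ℤ) * hOf d fr k + ((V.card : ℤ) - VF.card) * hOf d f k by
    rw [hs, hsum, hfrk] at hle
    linarith
  have hb1 : ∀ v ∈ VF, (((𝓕.filter (fun G => v ∈ G)).filter
      (fun G => (insert v (R G)).card = k + 1)).card : ℤ) ≤ hOf d fr k := by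
    intro v hv
    obtain ⟨R', h1, -, h2⟩ := hA v hv
    exact star_bound hR h1 d hd v rfl h2 k hk
  have hb2 : ∀ v ∈ V \ VF, (((𝓕.filter (fun G => v ∈ G)).filter
      (fun G => (insert v (R G)).card = k + 1)).card : ℤ) ≤ hOf d f k := by
    intro v hv
    rw [mem_sdiff] at hv
    obtain ⟨R', h1, h2⟩ := hB v hv.1 hv.2
    refine star_bound hR h1 d hd v ?_ h2 k hk
    rw [h𝓡, filter_filter]
    apply filter_congr
    intro σ _
    constructor
    · tauto
    · exact fun h => ⟨fun h3 => hv.2 (h3 h), h⟩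
  rw [← sum_sdiff hVF]
  have c1 := sum_le_card_nsmul VF _ _ hb1
  have c2 := sum_le_card_nsmul (V \ VF) _ _ hb2
  rw [card_sdiff_of_subset hVF] at c2
  have := card_le_card hVF
  simp only [nsmul_eq_mul] at c1 c2
  push_cast [this] at c2
  linarith

end comb

set_option linter.unusedSectionVars false

section core

variable {E : Type*} [AddCommGroup E] [Module ℝ E] [FiniteDimensional ℝ E]
variable {ι : Type*} [DecidableEq ι]

open Classical in
def Tset (V : Finset ι) (x : ι → E) (a : Module.Dual ℝ E) : Finset ι :=
  V.filter (fun i => a (x i) = 1)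

theorem mem_Tset {V : Finset ι} {x : ι → E} {a : Module.Dual ℝ E} {i : ι} :
    i ∈ Tset V x a ↔ i ∈ V ∧ a (x i) = 1 := by
  unfold Tset
  rw [mem_filter]

structure IsA (V : Finset ι) (x : ι → E) (a : Module.Dual ℝ E) : Prop where
  le : ∀ i ∈ V, a (x i) ≤ 1
  span : Submodule.span ℝ (x '' (Tset V x a : Set ι)) = ⊤

theorem ext_T {S : Set ι} {x : ι → E} (hs : Submodule.span ℝ (x '' S) = ⊤)
    {g g' : Module.Dual ℝ E} (h : ∀ i ∈ S, g (x i) = g' (x i)) : g = g' := by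
  apply LinearMap.ext_on hs
  rintro _ ⟨i, hi, rfl⟩
  exact h i hi

theorem IsA.eq_of_subset {V : Finset ι} {x : ι → E} {a a' : Module.Dual ℝ E}
    (h : IsA V x a) (hs : Tset V x a ⊆ Tset V x a') : a = a' := by
  apply ext_T h.span
  intro i hi
  rw [(mem_Tset.1 (mem_coe.1 hi)).2, (mem_Tset.1 (hs (mem_coe.1 hi))).2]

theorem finite_A (V : Finset ι) (x : ι → E) : {a | IsA V x a}.Finite := by
  apply Set.Finite.of_finite_image (f := Tset V x)
  · apply Set.Finite.subset (V.powerset : Finset (Finset ι)).finite_toSet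
    rintro _ ⟨a, _, rfl⟩
    simp only [coe_powerset, Set.mem_preimage, Set.mem_powerset_iff, coe_subset]
    intro i hi
    exact (mem_Tset.1 hi).1
  · intro a ha a' _ h
    exact IsA.eq_of_subset ha (le_of_eq h)

theorem rotate {V : Finset ι} {x : ι → E}
    (hneg : ∀ e : Module.Dual ℝ E, e ≠ 0 → ∃ i ∈ V, e (x i) < 0)
    (b e : Module.Dual ℝ E) (hb : ∀ i ∈ V, b (x i) ≤ 1) (he : e ≠ 0)
    (hT : ∀ i ∈ Tset V x b, e (x i) ≤ 0) :
    ∃ t : ℝ, 0 < t ∧ (∀ i ∈ V, (b + t • e) (x i) ≤ 1) ∧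
      ∃ j ∈ V, 0 < e (x j) ∧ (b + t • e) (x j) = 1 := by
  classical
  set J := V.filter (fun j => 0 < e (x j)) with hJ
  have hJne : J.Nonempty := by
    obtain ⟨i, hi, h⟩ := hneg (-e) (neg_ne_zero.2 he)
    exact ⟨i, mem_filter.2 ⟨hi, by simpa using h⟩⟩
  obtain ⟨j, hj, hmin⟩ := exists_min_image J (fun j => (1 - b (x j)) / e (x j)) hJne
  rw [mem_filter] at hj
  have hlt : b (x j) < 1 := by
    refine lt_of_le_of_ne (hb j hj.1) (fun h => ?_)
    have := hT j (mem_Tset.2 ⟨hj.1, h⟩)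
    linarith [hj.2]
  refine ⟨(1 - b (x j)) / e (x j), div_pos (by linarith) hj.2, ?_, j, hj.1, hj.2, ?_⟩
  · intro i hi
    simp only [LinearMap.add_apply, LinearMap.smul_apply, smul_eq_mul]
    by_cases h : 0 < e (x i)
    · have := hmin i (mem_filter.2 ⟨hi, h⟩)
      rw [le_div_iff₀ h] at this
      linarith
    · have h1 : 0 < (1 - b (x j)) / e (x j) := div_pos (by linarith) hj.2
      have h2 := hb i hi
      nlinarith
  · simp only [LinearMap.add_apply, LinearMap.smul_apply, smul_eq_mul]
    rw [div_mul_cancel₀ _ hj.2.ne']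
    ring

theorem exists_dual_of_ne_top (W : Submodule ℝ E) (h : W ≠ ⊤) :
    ∃ e : Module.Dual ℝ E, e ≠ 0 ∧ ∀ w ∈ W, e w = 0 := by
  obtain ⟨f, hf, hW⟩ := Submodule.exists_le_ker_of_lt_top W (lt_top_iff_ne_top.2 h)
  exact ⟨f, hf, fun w hw => hW hw⟩

theorem mem_hull {V : Finset ι} {x : ι → E}
    (hneg : ∀ e : Module.Dual ℝ E, e ≠ 0 → ∃ i ∈ V, e (x i) < 0) (m : ℕ) :
    ∀ b : Module.Dual ℝ E, (∀ i ∈ V, b (x i) ≤ 1) →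
      Module.finrank ℝ E ≤ m + Module.finrank ℝ (Submodule.span ℝ (x '' (Tset V x b : Set ι))) →
      b ∈ convexHull ℝ {a | IsA V x a ∧ Tset V x b ⊆ Tset V x a} := by
  induction m with
  | zero =>
    intro b hb hr
    apply subset_convexHull
    refine ⟨⟨hb, ?_⟩, subset_rfl⟩
    apply Submodule.eq_top_of_finrank_eq
    have := Submodule.finrank_le (Submodule.span ℝ (x '' (Tset V x b : Set ι)))
    omega
  | succ m ih =>
    intro b hb hr
    by_cases htop : Submodule.span ℝ (x '' (Tset V x b : Set ι)) = ⊤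
    · exact subset_convexHull _ _ ⟨⟨hb, htop⟩, subset_rfl⟩
    obtain ⟨e, he, hW⟩ := exists_dual_of_ne_top _ htop
    have hz : ∀ i ∈ Tset V x b, e (x i) = 0 := fun i hi =>
      hW _ (Submodule.subset_span ⟨i, hi, rfl⟩)
    have key : ∀ e : Module.Dual ℝ E, e ≠ 0 →
        (∀ w ∈ Submodule.span ℝ (x '' (Tset V x b : Set ι)), e w = 0) →
        ∃ t : ℝ, 0 < t ∧
          b + t • e ∈ convexHull ℝ {a | IsA V x a ∧ Tset V x b ⊆ Tset V x a} := by
      intro e he hW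
      have hz : ∀ i ∈ Tset V x b, e (x i) = 0 := fun i hi =>
        hW _ (Submodule.subset_span ⟨i, hi, rfl⟩)
      obtain ⟨t, ht, h1, j, hj, h2, h3⟩ := rotate hneg b e hb he (fun i hi => (hz i hi).le)
      refine ⟨t, ht, ?_⟩
      have hsub : Tset V x b ⊆ Tset V x (b + t • e) := by
        intro i hi
        rw [mem_Tset]
        refine ⟨(mem_Tset.1 hi).1, ?_⟩
        simp [hz i hi, (mem_Tset.1 hi).2]
      have hlt : Submodule.span ℝ (x '' (Tset V x b : Set ι))
          < Submodule.span ℝ (x '' (Tset V x (b + t • e) : Set ι)) := by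
        refine lt_of_le_of_ne (Submodule.span_mono (Set.image_mono (coe_subset.2 hsub))) ?_
        intro h
        have : x j ∈ Submodule.span ℝ (x '' (Tset V x b : Set ι)) := by
          rw [h]
          exact Submodule.subset_span ⟨j, mem_coe.2 (mem_Tset.2 ⟨hj, h3⟩), rfl⟩
        have := hW _ this
        linarith
      have := Submodule.finrank_lt_finrank_of_lt hlt
      refine convexHull_mono ?_ (ih (b + t • e) h1 (by omega))
      intro a ha
      exact ⟨ha.1, hsub.trans ha.2⟩
    obtain ⟨t1, ht1, h1⟩ := key e he hW
    obtain ⟨t2, ht2, h2⟩ := key (-e) (neg_ne_zero.2 he) (fun w hw => by simp [hW w hw])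
    have := (convex_convexHull ℝ {a | IsA V x a ∧ Tset V x b ⊆ Tset V x a}) h1 h2
      (a := t2 / (t1 + t2)) (b := t1 / (t1 + t2)) (by positivity) (by positivity)
      (by field_simp; ring)
    convert this using 1
    ext w
    simp
    field_simp
    ring

theorem exists_other {V : Finset ι} {x : ι → E}
    (hneg : ∀ e : Module.Dual ℝ E, e ≠ 0 → ∃ i ∈ V, e (x i) < 0)
    (b aF : Module.Dual ℝ E) (hb : ∀ i ∈ V, b (x i) ≤ 1) (hF : IsA V x aF)
    (hne : Submodule.span ℝ (x '' (Tset V x b : Set ι)) ≠ ⊤) :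
    ∃ a, IsA V x a ∧ a ≠ aF ∧ Tset V x b ⊆ Tset V x a := by
  by_contra! hcon
  have h := mem_hull hneg (Module.finrank ℝ E) b hb (by omega)
  have h2 : {a | IsA V x a ∧ Tset V x b ⊆ Tset V x a} ⊆ {aF} := by
    intro a ha
    by_contra h3
    exact hcon a ha.1 h3 ha.2
  have h3 := convexHull_mono h2 h
  rw [convexHull_singleton] at h3
  rw [Set.mem_singleton_iff] at h3
  rw [h3] at hne
  exact hne hF.span

/-- dual coordinates on an (independent) set -/
def IsDual (x : ι → E) (G : Finset ι) (v : ι) (e : Module.Dual ℝ E) : Prop :=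
  e (x v) = 1 ∧ ∀ w ∈ G, w ≠ v → e (x w) = 0

open Classical in
def dc (x : ι → E) (G : Finset ι) (v : ι) : Module.Dual ℝ E :=
  if h : ∃ e, IsDual x G v e then h.choose else 0

theorem dc_spec {x : ι → E} {G : Finset ι} {v : ι} (h : ∃ e, IsDual x G v e) :
    IsDual x G v (dc x G v) := by
  unfold dc
  rw [dif_pos h]
  exact h.choose_spec

theorem exists_isDual {x : ι → E} {G : Finset ι}
    (hs : Submodule.span ℝ (x '' (G : Set ι)) = ⊤) (hc : G.card = Module.finrank ℝ E)
    (v : ι) (hv : v ∈ G) : ∃ e, IsDual x G v e := by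
  classical
  have hli : LinearIndependent ℝ (fun i : G => x i) := by
    apply linearIndependent_of_top_le_span_of_card_eq_finrank
    · rw [← hs]
      apply Submodule.span_mono
      rintro _ ⟨i, hi, rfl⟩
      exact ⟨⟨i, hi⟩, rfl⟩
    · simpa using hc
  have hsp : ⊤ ≤ Submodule.span ℝ (Set.range (fun i : G => x i)) := by
    rw [← hs]
    apply Submodule.span_mono
    rintro _ ⟨i, hi, rfl⟩
    exact ⟨⟨i, hi⟩, rfl⟩
  let B := Module.Basis.mk hli hsp
  refine ⟨B.coord ⟨v, hv⟩, ?_, ?_⟩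
  · have : x v = B ⟨v, hv⟩ := by simp [B]
    rw [this]
    simp
  · intro w hw hwv
    have : x w = B ⟨w, hw⟩ := by simp [B]
    rw [this]
    simp [hwv]

/-- A simplex facet normal. -/
structure IsS (V : Finset ι) (x : ι → E) (a : Module.Dual ℝ E) : Prop extends IsA V x a where
  dual : ∀ v ∈ Tset V x a, IsDual x (Tset V x a) v (dc x (Tset V x a) v)

theorem IsS.expand {V : Finset ι} {x : ι → E} {a : Module.Dual ℝ E} (h : IsS V x a)
    (g : Module.Dual ℝ E) : g = ∑ v ∈ Tset V x a, g (x v) • dc x (Tset V x a) v := by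
  apply ext_T h.span
  intro i hi
  rw [mem_coe] at hi
  rw [LinearMap.sum_apply, sum_eq_single i]
  · simp [(h.dual i hi).1]
  · intro v hv hvi
    simp [(h.dual v hv).2 i hi hvi.symm]
  · intro h; exact absurd hi h

theorem IsS.nb {V : Finset ι} {x : ι → E}
    (hneg : ∀ e : Module.Dual ℝ E, e ≠ 0 → ∃ i ∈ V, e (x i) < 0)
    {a : Module.Dual ℝ E} (h : IsS V x a) (v : ι) (hv : v ∈ Tset V x a) :
    ∃ a', ∃ t : ℝ, 0 < t ∧ IsA V x a' ∧ a' = a - t • dc x (Tset V x a) v ∧ v ∉ Tset V x a' ∧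
      ∀ w ∈ Tset V x a, w ≠ v → w ∈ Tset V x a' := by
  set e := dc x (Tset V x a) v
  have hd : IsDual x (Tset V x a) v e := h.dual v hv
  have he0 : -e ≠ 0 := by
    intro h0
    have h1 := hd.1
    have h2 : (-e) (x v) = 0 := by rw [h0]; simp
    rw [LinearMap.neg_apply] at h2
    linarith
  obtain ⟨t, ht, h1, j, hj, h2, h3⟩ := rotate hneg a (-e) h.le he0 (by
    intro i hi
    by_cases hiv : i = v
    · subst hiv; simp [hd.1]
    · rw [LinearMap.neg_apply, hd.2 i hi hiv]; simp)
  have hsub : ∀ w ∈ Tset V x a, w ≠ v → w ∈ Tset V x (a + t • -e) := by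
    intro w hw hwv
    rw [mem_Tset] at hw ⊢
    refine ⟨hw.1, ?_⟩
    simp [hd.2 w (mem_Tset.2 hw) hwv, hw.2]
  refine ⟨a + t • (-e), t, ht, ⟨h1, ?_⟩, by simp [sub_eq_add_neg], ?_, hsub⟩
  · by_contra htop
    obtain ⟨g, hg, hW⟩ := exists_dual_of_ne_top _ htop
    apply hg
    have hg1 : g = g (x v) • e := by
      conv_lhs => rw [h.expand g]
      rw [sum_eq_single v]
      · intro w hw hwv
        rw [hW (x w) (Submodule.subset_span ⟨w, mem_coe.2 (hsub w hw hwv), rfl⟩), zero_smul]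
      · intro h; exact absurd hv h
    have hj0 := hW (x j) (Submodule.subset_span ⟨j, mem_coe.2 (mem_Tset.2 ⟨hj, h3⟩), rfl⟩)
    rw [hg1, LinearMap.smul_apply, smul_eq_mul, mul_eq_zero] at hj0
    rw [LinearMap.neg_apply] at h2
    rcases hj0 with h0 | h0
    · rw [hg1, h0, zero_smul]
    · linarith
  · intro hc
    have := (mem_Tset.1 hc).2
    have h5 := (mem_Tset.1 hv).2
    simp only [LinearMap.add_apply, LinearMap.smul_apply, LinearMap.neg_apply, hd.1, h5,
      smul_eq_mul] at this
    linarith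

open Classical in
def Rs (x : ι → E) (u : E) (G : Finset ι) : Finset ι :=
  G.filter (fun v => 0 < dc x G v u)

theorem mem_Rs {x : ι → E} {u : E} {G : Finset ι} {v : ι} :
    v ∈ Rs x u G ↔ v ∈ G ∧ 0 < dc x G v u := by
  unfold Rs
  rw [mem_filter]

theorem IsS.min {V : Finset ι} {x : ι → E} {a a' : Module.Dual ℝ E} (h : IsS V x a) (u : E)
    (h' : IsA V x a') (σ : Finset ι) (h1 : Rs x u (Tset V x a) ⊆ σ)
    (h3 : σ ⊆ Tset V x a') : a u ≤ a' u := by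
  have he := h.expand (a' - a)
  have : (a' - a) u = ∑ v ∈ Tset V x a, (a' - a) (x v) * dc x (Tset V x a) v u := by
    conv_lhs => rw [he]
    rw [LinearMap.sum_apply]
    rfl
  have hnn : 0 ≤ (a' - a) u := by
    rw [this]
    apply sum_nonneg
    intro v hv
    rw [LinearMap.sub_apply, (mem_Tset.1 hv).2]
    by_cases hvs : v ∈ σ
    · rw [(mem_Tset.1 (h3 hvs)).2]; simp
    · have h5 : ¬ 0 < dc x (Tset V x a) v u := fun h6 => hvs (h1 (mem_Rs.2 ⟨hv, h6⟩))
      have h6 := h'.le v (mem_Tset.1 hv).1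
      push Not at h5
      nlinarith
  rw [LinearMap.sub_apply] at hnn
  linarith

/-- common hypotheses of the geometric core -/
structure Core (V : Finset ι) (x : ι → E) (aF : Module.Dual ℝ E)
    (𝓕 𝓟 : Finset (Finset ι)) : Prop where
  neg : ∀ e : Module.Dual ℝ E, e ≠ 0 → ∃ i ∈ V, e (x i) < 0
  isF : IsA V x aF
  simp : ∀ a, IsA V x a → a ≠ aF → IsS V x a
  memF : ∀ G, G ∈ 𝓕 ↔ ∃ a, IsA V x a ∧ a ≠ aF ∧ Tset V x a = G
  memP : ∀ σ, σ ∈ 𝓟 ↔ ∃ G ∈ 𝓕, σ ⊆ G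

theorem Core.min_ex {V : Finset ι} {x : ι → E} {aF : Module.Dual ℝ E}
    {𝓕 𝓟 : Finset (Finset ι)} (C : Core V x aF 𝓕 𝓟) (u : E)
    (σ : Finset ι) (hσ : ∃ a, IsA V x a ∧ σ ⊆ Tset V x a) :
    ∃ a, IsA V x a ∧ σ ⊆ Tset V x a ∧ (∀ a', IsA V x a' → σ ⊆ Tset V x a' → a u ≤ a' u) ∧
      (a ≠ aF → Rs x u (Tset V x a) ⊆ σ) := by
  have hfin : {a | IsA V x a ∧ σ ⊆ Tset V x a}.Finite :=
    (finite_A V x).subset (fun a ha => ha.1)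
  obtain ⟨a, ha, hmin⟩ := Set.exists_min_image _ (fun a : Module.Dual ℝ E => a u) hfin hσ
  refine ⟨a, ha.1, ha.2, fun a' h1 h2 => hmin a' ⟨h1, h2⟩, ?_⟩
  intro hne v hv
  by_contra hvs
  rw [mem_Rs] at hv
  obtain ⟨a', t, ht, h1, h2, h3, h4⟩ := (C.simp a ha.1 hne).nb C.neg v hv.1
  have := hmin a' ⟨h1, fun w hw => h4 w (ha.2 hw) (fun h => hvs (h ▸ hw))⟩
  rw [h2] at this
  simp only [LinearMap.sub_apply, LinearMap.smul_apply, smul_eq_mul] at this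
  nlinarith [hv.2]

theorem Core.part_last {V : Finset ι} {x : ι → E} {aF : Module.Dual ℝ E}
    {𝓕 𝓟 : Finset (Finset ι)} (C : Core V x aF 𝓕 𝓟) (u : E)
    (inj : ∀ a a', IsA V x a → IsA V x a' → a u = a' u → a = a')
    (last : ∀ a, IsA V x a → a ≠ aF → a u < aF u) : Part 𝓕 (Rs x u) 𝓟 where
  sub := fun G _ v hv => (mem_Rs.1 hv).1
  ex := by
    intro σ hσ
    obtain ⟨G, hG, hs⟩ := (C.memP σ).1 hσ
    obtain ⟨a0, h0, h0F, rfl⟩ := (C.memF G).1 hG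
    obtain ⟨a, h1, h2, h3, h4⟩ := C.min_ex u σ ⟨a0, h0, hs⟩
    have hne : a ≠ aF := by
      rintro rfl
      have := h3 a0 h0 hs
      have := last a0 h0 h0F
      linarith
    exact ⟨_, (C.memF _).2 ⟨a, h1, hne, rfl⟩, h4 hne, h2⟩
  mem := fun G hG σ _ h => (C.memP σ).2 ⟨G, hG, h⟩
  uniq := by
    intro G hG G' hG' σ h1 h2 h3 h4
    obtain ⟨a, ha, haF, rfl⟩ := (C.memF G).1 hG
    obtain ⟨a', ha', haF', rfl⟩ := (C.memF G').1 hG'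
    rw [inj a a' ha ha' (le_antisymm ((C.simp a ha haF).min u ha' σ h1 h4)
      ((C.simp a' ha' haF').min u ha σ h3 h2))]

theorem Core.part_first {V : Finset ι} {x : ι → E} {aF : Module.Dual ℝ E}
    {𝓕 𝓟 : Finset (Finset ι)} (C : Core V x aF 𝓕 𝓟) (u : E)
    (inj : ∀ a a', IsA V x a → IsA V x a' → a u = a' u → a = a')
    (first : ∀ a, IsA V x a → a ≠ aF → aF u < a u) :
    Part 𝓕 (Rs x u) (𝓟.filter (fun σ => ¬ σ ⊆ Tset V x aF)) where
  sub := fun G _ v hv => (mem_Rs.1 hv).1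
  ex := by
    intro σ hσ
    rw [mem_filter] at hσ
    obtain ⟨G, hG, hs⟩ := (C.memP σ).1 hσ.1
    obtain ⟨a0, h0, h0F, rfl⟩ := (C.memF G).1 hG
    obtain ⟨a, h1, h2, h3, h4⟩ := C.min_ex u σ ⟨a0, h0, hs⟩
    have hne : a ≠ aF := by
      rintro rfl
      exact hσ.2 h2
    exact ⟨_, (C.memF _).2 ⟨a, h1, hne, rfl⟩, h4 hne, h2⟩
  mem := by
    intro G hG σ h1 h
    refine mem_filter.2 ⟨(C.memP σ).2 ⟨G, hG, h⟩, fun hF => ?_⟩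
    obtain ⟨a, ha, haF, rfl⟩ := (C.memF G).1 hG
    have := (C.simp a ha haF).min u C.isF σ h1 hF
    have := first a ha haF
    linarith
  uniq := by
    intro G hG G' hG' σ h1 h2 h3 h4
    obtain ⟨a, ha, haF, rfl⟩ := (C.memF G).1 hG
    obtain ⟨a', ha', haF', rfl⟩ := (C.memF G').1 hG'
    rw [inj a a' ha ha' (le_antisymm ((C.simp a ha haF).min u ha' σ h1 h4)
      ((C.simp a' ha' haF').min u ha σ h3 h2))]

theorem Core.dc_ne {V : Finset ι} {x : ι → E} {aF : Module.Dual ℝ E}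
    {𝓕 𝓟 : Finset (Finset ι)} (C : Core V x aF 𝓕 𝓟) (u : E)
    (inj : ∀ a a', IsA V x a → IsA V x a' → a u = a' u → a = a')
    (G : Finset ι) (hG : G ∈ 𝓕) (v : ι) (hv : v ∈ G) : dc x G v u ≠ 0 := by
  obtain ⟨a, ha, haF, rfl⟩ := (C.memF G).1 hG
  obtain ⟨a', t, ht, h1, h2, h3, h4⟩ := (C.simp a ha haF).nb C.neg v hv
  intro h0
  have : a' u = a u := by rw [h2]; simp [h0]
  rw [inj a' a h1 ha this] at h3
  exact h3 hv

theorem Core.not_mem_R {V : Finset ι} {x : ι → E} {aF : Module.Dual ℝ E}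
    {𝓕 𝓟 : Finset (Finset ι)} (C : Core V x aF 𝓕 𝓟) (u : E) (v : ι)
    (hu : ∀ a a', IsA V x a → IsA V x a' → v ∈ Tset V x a → v ∉ Tset V x a' → a u < a' u)
    (G : Finset ι) (hG : G ∈ 𝓕) (hv : v ∈ G) : v ∉ Rs x u G := by
  obtain ⟨a, ha, haF, rfl⟩ := (C.memF G).1 hG
  obtain ⟨a', t, ht, h1, h2, h3, h4⟩ := (C.simp a ha haF).nb C.neg v hv
  intro h0
  have := hu a a' ha h1 hv h3
  rw [h2] at this
  simp only [LinearMap.sub_apply, LinearMap.smul_apply, smul_eq_mul] at this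
  nlinarith [(mem_Rs.1 h0).2]

theorem Core.part_compl {V : Finset ι} {x : ι → E} {aF : Module.Dual ℝ E}
    {𝓕 𝓟 : Finset (Finset ι)} (C : Core V x aF 𝓕 𝓟) (u : E)
    (inj : ∀ a a', IsA V x a → IsA V x a' → a u = a' u → a = a')
    (first : ∀ a, IsA V x a → a ≠ aF → aF u < a u) :
    Part 𝓕 (fun G => G \ Rs x u G) 𝓟 := by
  have h := C.part_last (-u) (fun a a' ha ha' h => inj a a' ha ha' (by simpa using h))
    (fun a ha h => by simpa using first a ha h)
  have e : ∀ G ∈ 𝓕, G \ Rs x u G = Rs x (-u) G := by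
    intro G hG
    ext v
    rw [mem_sdiff, mem_Rs, mem_Rs]
    constructor
    · rintro ⟨h1, h2⟩
      refine ⟨h1, ?_⟩
      have h3 := C.dc_ne u inj G hG v h1
      have h4 : ¬ 0 < dc x G v u := fun h => h2 ⟨h1, h⟩
      rw [map_neg]
      push Not at h4
      have := lt_of_le_of_ne h4 h3
      linarith
    · rintro ⟨h1, h2⟩
      rw [map_neg] at h2
      exact ⟨h1, fun h => by linarith [h.2]⟩
  constructor
  · intro G _; exact sdiff_subset
  · intro σ hσ
    obtain ⟨G, hG, h1, h2⟩ := h.ex σ hσ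
    exact ⟨G, hG, by rw [e G hG]; exact h1, h2⟩
  · intro G hG σ h1 h2
    rw [e G hG] at h1
    exact h.mem G hG σ h1 h2
  · intro G hG G' hG' σ h1 h2 h3 h4
    rw [e G hG] at h1
    rw [e G' hG'] at h3
    exact h.uniq G hG G' hG' σ h1 h2 h3 h4

theorem perturb (A : Set (Module.Dual ℝ E)) (hA : A.Finite) (u w : E) :
    ∃ u' : E, ∀ a ∈ A, ∀ a' ∈ A, (a u < a' u → a u' < a' u') ∧
      (a u = a' u → a w < a' w → a u' < a' u') := by
  have key : ∀ᶠ ε in nhdsWithin (0 : ℝ) (Set.Ioi 0), ∀ p ∈ A ×ˢ A,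
      (p.1 u < p.2 u → p.1 (u + ε • w) < p.2 (u + ε • w)) ∧
      (p.1 u = p.2 u → p.1 w < p.2 w → p.1 (u + ε • w) < p.2 (u + ε • w)) := by
    rw [Filter.eventually_all_finite (hA.prod hA)]
    rintro ⟨a, a'⟩ -
    simp only [map_add, map_smul, smul_eq_mul]
    apply Filter.Eventually.and
    · by_cases h : a u < a' u
      · have hc : Filter.Tendsto (fun ε : ℝ => (a' u + ε * a' w) - (a u + ε * a w))
            (nhdsWithin 0 (Set.Ioi 0)) (nhds (a' u - a u)) := by
          apply Filter.Tendsto.mono_left _ nhdsWithin_le_nhds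
          have : Continuous (fun ε : ℝ => (a' u + ε * a' w) - (a u + ε * a w)) := by fun_prop
          simpa using this.tendsto 0
        filter_upwards [hc.eventually (lt_mem_nhds (show 0 < a' u - a u by linarith))] with ε hε _
        linarith
      · exact Filter.Eventually.of_forall (fun ε h' => absurd h' h)
    · filter_upwards [self_mem_nhdsWithin] with ε hε h1 h2
      have : 0 < ε := hε
      nlinarith
  obtain ⟨ε, hε⟩ := key.exists
  exact ⟨u + ε • w, fun a ha a' ha' => hε (a, a') ⟨ha, ha'⟩⟩

theorem generic (A : Set (Module.Dual ℝ E)) (hA : A.Finite) (u : E) :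
    ∃ u' : E, (∀ a ∈ A, ∀ a' ∈ A, a u < a' u → a u' < a' u') ∧
      ∀ a ∈ A, ∀ a' ∈ A, a u' = a' u' → a = a' := by
  obtain ⟨w, hw⟩ : ∃ w : E, ∀ a ∈ A, ∀ a' ∈ A, a w = a' w → a = a' := by
    have hfin : Finite {p : Module.Dual ℝ E × Module.Dual ℝ E // p ∈ A ×ˢ A ∧ p.1 ≠ p.2} :=
      ((hA.prod hA).subset (fun p (hp : p ∈ A ×ˢ A ∧ p.1 ≠ p.2) => hp.1)).to_subtype
    obtain ⟨w, hw⟩ := Module.Dual.exists_forall_ne_zero_of_forall_exists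
      (fun p : {p : Module.Dual ℝ E × Module.Dual ℝ E // p ∈ A ×ˢ A ∧ p.1 ≠ p.2} =>
        p.1.1 - p.1.2) (by
        rintro ⟨p, hp, hne⟩
        by_contra! h
        exact hne (sub_eq_zero.1 (LinearMap.ext h)))
    refine ⟨w, fun a ha a' ha' h => ?_⟩
    by_contra hne
    apply hw ⟨(a, a'), ⟨ha, ha'⟩, hne⟩
    simp [h]
  obtain ⟨u', hu'⟩ := perturb A hA u w
  refine ⟨u', fun a ha a' ha' => (hu' a ha a' ha').1, ?_⟩
  intro a ha a' ha' h
  by_contra hne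
  rcases lt_trichotomy (a u) (a' u) with h1 | h1 | h1
  · have := (hu' a ha a' ha').1 h1
    linarith
  · rcases lt_trichotomy (a w) (a' w) with h2 | h2 | h2
    · have := (hu' a ha a' ha').2 h1 h2
      linarith
    · exact hne (hw a ha a' ha' h2)
    · have := (hu' a' ha' a ha).2 h1.symm h2
      linarith
  · have := (hu' a' ha' a ha).1 h1
    linarith

theorem Core.hA {V : Finset ι} {x : ι → E} {aF : Module.Dual ℝ E}
    {𝓕 𝓟 : Finset (Finset ι)} (C : Core V x aF 𝓕 𝓟) (v : ι) (hv : v ∈ Tset V x aF) :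
    ∃ R, Part 𝓕 R (𝓟.filter (fun σ => ¬ σ ⊆ Tset V x aF)) ∧
      Part 𝓕 (fun G => G \ R G) 𝓟 ∧ ∀ G ∈ 𝓕, v ∈ G → v ∉ R G := by
  obtain ⟨u1, hu1⟩ := perturb {a | IsA V x a} (finite_A V x) (-x v)
    (-∑ i ∈ Tset V x aF, x i)
  obtain ⟨u, hu, inj⟩ := generic {a | IsA V x a} (finite_A V x) u1
  have hvlt : ∀ a, IsA V x a → v ∉ Tset V x a → a (x v) < 1 := by
    intro a ha h
    have hvV := (mem_Tset.1 hv).1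
    exact lt_of_le_of_ne (ha.le v hvV) (fun h1 => h (mem_Tset.2 ⟨hvV, h1⟩))
  have hord : ∀ a a', IsA V x a → IsA V x a' → v ∈ Tset V x a → v ∉ Tset V x a' →
      a u < a' u := by
    intro a a' ha ha' h1 h2
    apply hu a ha a' ha'
    apply (hu1 a ha a' ha').1
    rw [map_neg, map_neg, (mem_Tset.1 h1).2]
    linarith [hvlt a' ha' h2]
  have hinj : ∀ a a', IsA V x a → IsA V x a' → a u = a' u → a = a' :=
    fun a a' ha ha' h => inj a ha a' ha' h
  have hfirst : ∀ a, IsA V x a → a ≠ aF → aF u < a u := by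
    intro a ha hne
    by_cases hva : v ∈ Tset V x a
    · apply hu _ C.isF a ha
      apply (hu1 _ C.isF a ha).2
      · rw [map_neg, map_neg, (mem_Tset.1 hv).2, (mem_Tset.1 hva).2]
      · rw [map_neg, map_neg, map_sum, map_sum, neg_lt_neg_iff]
        apply sum_lt_sum
        · intro i hi
          rw [(mem_Tset.1 hi).2]
          exact ha.le i (mem_Tset.1 hi).1
        · by_contra! hcon
          apply hne
          symm
          apply C.isF.eq_of_subset
          intro i hi
          refine mem_Tset.2 ⟨(mem_Tset.1 hi).1, le_antisymm (ha.le i (mem_Tset.1 hi).1) ?_⟩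
          have := hcon i hi
          rwa [(mem_Tset.1 hi).2] at this
    · exact hord aF a C.isF ha hv hva
  exact ⟨Rs x u, C.part_first u hinj hfirst, C.part_compl u hinj hfirst,
    C.not_mem_R u v hord⟩

theorem Core.hB {V : Finset ι} {x : ι → E} {aF : Module.Dual ℝ E}
    {𝓕 𝓟 : Finset (Finset ι)} (C : Core V x aF 𝓕 𝓟) (v : ι) (hvV : v ∈ V)
    (hsum : x v = - ∑ i ∈ Tset V x aF, x i) :
    ∃ R, Part 𝓕 R 𝓟 ∧ ∀ G ∈ 𝓕, v ∈ G → v ∉ R G := by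
  obtain ⟨u, hu, inj⟩ := generic {a | IsA V x a} (finite_A V x) (-x v)
  have hvlt : ∀ a, IsA V x a → v ∉ Tset V x a → a (x v) < 1 := by
    intro a ha h
    exact lt_of_le_of_ne (ha.le v hvV) (fun h1 => h (mem_Tset.2 ⟨hvV, h1⟩))
  have hord : ∀ a a', IsA V x a → IsA V x a' → v ∈ Tset V x a → v ∉ Tset V x a' →
      a u < a' u := by
    intro a a' ha ha' h1 h2
    apply hu a ha a' ha'
    rw [map_neg, map_neg, (mem_Tset.1 h1).2]
    linarith [hvlt a' ha' h2]
  have hinj : ∀ a a', IsA V x a → IsA V x a' → a u = a' u → a = a' :=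
    fun a a' ha ha' h => inj a ha a' ha' h
  have hlast : ∀ a, IsA V x a → a ≠ aF → a u < aF u := by
    intro a ha hne
    apply hu a ha _ C.isF
    rw [hsum, neg_neg, map_sum, map_sum]
    apply sum_lt_sum
    · intro i hi
      rw [(mem_Tset.1 hi).2]
      exact ha.le i (mem_Tset.1 hi).1
    · by_contra! hcon
      apply hne
      symm
      apply C.isF.eq_of_subset
      intro i hi
      refine mem_Tset.2 ⟨(mem_Tset.1 hi).1, le_antisymm (ha.le i (mem_Tset.1 hi).1) ?_⟩
      have := hcon i hi
      rwa [(mem_Tset.1 hi).2] at this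
  exact ⟨Rs x u, C.part_last u hinj hlast, C.not_mem_R u v hord⟩

end core

section geom

variable {d : ℕ}

theorem dotp_eq (b x : Fin d → ℝ) : dotp b x = dotProductEquiv ℝ (Fin d) b x := by
  simp [dotp, dotProduct]

open Classical in
def Fs (W : Finset (Fin d → ℝ)) (b : Module.Dual ℝ (Fin d → ℝ)) (c : ℝ) :
    Finset (Fin d → ℝ) := W.filter (fun w => b w = c)

theorem mem_Fs {W : Finset (Fin d → ℝ)} {b : Module.Dual ℝ (Fin d → ℝ)} {c : ℝ}
    {w : Fin d → ℝ} : w ∈ Fs W b c ↔ w ∈ W ∧ b w = c := by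
  unfold Fs
  rw [mem_filter]

theorem hull_le {W : Finset (Fin d → ℝ)} {b : Module.Dual ℝ (Fin d → ℝ)} {c : ℝ}
    (h : ∀ w ∈ W, b w ≤ c) : ∀ x ∈ convexHull ℝ (W : Set (Fin d → ℝ)), b x ≤ c := by
  intro x hx
  have : convexHull ℝ (W : Set (Fin d → ℝ)) ⊆ {x | b x ≤ c} :=
    convexHull_min (fun w hw => h w hw) (convex_halfSpace_le b.isLinear c)
  exact this hx

theorem face_hull {W : Finset (Fin d → ℝ)} {b : Module.Dual ℝ (Fin d → ℝ)} {c : ℝ}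
    (h : ∀ w ∈ W, b w ≤ c) :
    {x ∈ convexHull ℝ (W : Set (Fin d → ℝ)) | b x = c}
      = convexHull ℝ (Fs W b c : Set (Fin d → ℝ)) := by
  ext x
  constructor
  · rintro ⟨hx, hbx⟩
    rw [Finset.mem_convexHull'] at hx
    obtain ⟨t, ht0, ht1, rfl⟩ := hx
    have hz : ∀ w ∈ W, t w * (c - b w) = 0 := by
      rw [← sum_eq_zero_iff_of_nonneg
        (fun w hw => mul_nonneg (ht0 w hw) (by linarith [h w hw]))]
      simp only [mul_sub, sum_sub_distrib, ← sum_mul, ht1]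
      rw [map_sum] at hbx
      simp only [map_smul, smul_eq_mul] at hbx
      rw [hbx]
      ring
    rw [Finset.mem_convexHull']
    have hsub : Fs W b c ⊆ W := fun w hw => (mem_Fs.1 hw).1
    have hz' : ∀ w ∈ W, w ∉ Fs W b c → t w = 0 := by
      intro w hw hn
      rcases mul_eq_zero.1 (hz w hw) with h1 | h1
      · exact h1
      · exact absurd (mem_Fs.2 ⟨hw, by linarith⟩) hn
    refine ⟨t, fun w hw => ht0 w (hsub hw), ?_, ?_⟩
    · rw [← ht1]
      exact sum_subset hsub hz'
    · exact sum_subset hsub (fun w hw hn => by rw [hz' w hw hn, zero_smul])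
  · intro hx
    refine ⟨convexHull_mono (fun w hw => (mem_Fs.1 (mem_coe.1 hw)).1) hx, ?_⟩
    have : convexHull ℝ (Fs W b c : Set (Fin d → ℝ)) ⊆ {x | b x = c} :=
      convexHull_min (fun w hw => (mem_Fs.1 (mem_coe.1 hw)).2) (convex_hyperplane b.isLinear c)
    exact this hx

theorem isFace_of {W : Finset (Fin d → ℝ)} {b : Module.Dual ℝ (Fin d → ℝ)} {c : ℝ}
    (h : ∀ w ∈ W, b w ≤ c) (hb : b ≠ 0) :
    IsFaceOf (convexHull ℝ (W : Set (Fin d → ℝ))) (convexHull ℝ (Fs W b c : Set (Fin d → ℝ))) := by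
  right; right
  have e : ∀ x, dotp ((dotProductEquiv ℝ (Fin d)).symm b) x = b x := by
    intro x
    rw [dotp_eq, LinearEquiv.apply_symm_apply]
  refine ⟨(dotProductEquiv ℝ (Fin d)).symm b, c, ?_, ?_, ?_⟩
  · simpa using hb
  · intro x hx
    rw [e]
    exact hull_le h x hx
  · simp only [e]
    exact (face_hull h).symm

theorem of_isFace {W : Finset (Fin d → ℝ)} {G : Set (Fin d → ℝ)}
    (h : IsFaceOf (convexHull ℝ (W : Set (Fin d → ℝ))) G) (hne : G.Nonempty)
    (hG : G ≠ convexHull ℝ (W : Set (Fin d → ℝ))) :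
    ∃ (b : Module.Dual ℝ (Fin d → ℝ)) (c : ℝ), b ≠ 0 ∧ (∀ w ∈ W, b w ≤ c) ∧
      G = convexHull ℝ (Fs W b c : Set (Fin d → ℝ)) := by
  rcases h with h | h | ⟨b, c, hb, hle, rfl⟩
  · exact absurd h hne.ne_empty
  · exact absurd h hG
  · simp only [dotp_eq] at hle ⊢
    have hle' : ∀ w ∈ W, dotProductEquiv ℝ (Fin d) b w ≤ c :=
      fun w hw => hle w (subset_convexHull _ _ hw)
    exact ⟨dotProductEquiv ℝ (Fin d) b, c, by simpa using hb, hle', face_hull hle'⟩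

theorem polyDim_hull (S : Set (Fin d → ℝ)) :
    polyDim (convexHull ℝ S) = Module.finrank ℝ (vectorSpan ℝ S) := by
  unfold polyDim
  rw [affineSpan_convexHull, direction_affineSpan]

theorem verts_hull {P : Set (Fin d → ℝ)} {V T : Finset (Fin d → ℝ)}
    (hV : (V : Set (Fin d → ℝ)) = verts P) (hP : P = convexHull ℝ (V : Set (Fin d → ℝ)))
    (hT : T ⊆ V) : verts (convexHull ℝ (T : Set (Fin d → ℝ))) = T := by
  apply Set.Subset.antisymm
  · exact extremePoints_convexHull_subset
  · intro x hx
    have hsub : convexHull ℝ (T : Set (Fin d → ℝ)) ⊆ P := by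
      rw [hP]
      exact convexHull_mono (coe_subset.2 hT)
    apply inter_extremePoints_subset_extremePoints_of_subset (𝕜 := ℝ) hsub
    · refine ⟨subset_convexHull _ _ hx, ?_⟩
      have : x ∈ (V : Set (Fin d → ℝ)) := hT hx
      rw [hV] at this
      exact this

theorem hull_inj {P : Set (Fin d → ℝ)} {V T T' : Finset (Fin d → ℝ)}
    (hV : (V : Set (Fin d → ℝ)) = verts P) (hP : P = convexHull ℝ (V : Set (Fin d → ℝ)))
    (hT : T ⊆ V) (hT' : T' ⊆ V)
    (h : convexHull ℝ (T : Set (Fin d → ℝ)) = convexHull ℝ (T' : Set (Fin d → ℝ))) : T = T' := by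
  have h1 := verts_hull hV hP hT
  rw [h, verts_hull hV hP hT'] at h1
  exact (coe_injective h1).symm

theorem exists_V {P : Set (Fin d → ℝ)} (h : IsPolytope P) :
    ∃ V : Finset (Fin d → ℝ), (V : Set (Fin d → ℝ)) = verts P ∧
      P = convexHull ℝ (V : Set (Fin d → ℝ)) := by
  obtain ⟨W, rfl⟩ := h
  have hfin : (verts (convexHull ℝ (W : Set (Fin d → ℝ)))).Finite :=
    W.finite_toSet.subset extremePoints_convexHull_subset
  refine ⟨hfin.toFinset, by simp, ?_⟩
  have hc : IsCompact (convexHull ℝ (W : Set (Fin d → ℝ))) := W.finite_toSet.isCompact_convexHull ℝ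
  have := closure_convexHull_extremePoints hc (convex_convexHull ℝ _)
  rw [IsClosed.closure_eq] at this
  · rw [Set.Finite.coe_toFinset]
    exact this.symm
  · exact hfin.isClosed_convexHull ℝ

theorem finrank_span_sub (o : Fin d → ℝ) (S : Set (Fin d → ℝ)) (hS : S.Nonempty)
    (b : Module.Dual ℝ (Fin d → ℝ)) (hb : ∀ s ∈ S, b (s - o) = 1) :
    Module.finrank ℝ (Submodule.span ℝ ((fun s => s - o) '' S))
      = Module.finrank ℝ (vectorSpan ℝ S) + 1 := by
  obtain ⟨p, hp⟩ := hS
  have hker : vectorSpan ℝ S ≤ LinearMap.ker b := by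
    rw [vectorSpan_eq_span_vsub_set_right ℝ hp, Submodule.span_le]
    rintro _ ⟨s, hs, rfl⟩
    have h1 := hb s hs
    have h2 := hb p hp
    simp only [vsub_eq_sub, SetLike.mem_coe, LinearMap.mem_ker, map_sub] at *
    linarith
  have e : Submodule.span ℝ ((fun s => s - o) '' S)
      = vectorSpan ℝ S ⊔ Submodule.span ℝ {p - o} := by
    apply le_antisymm
    · rw [Submodule.span_le]
      rintro _ ⟨s, hs, rfl⟩
      have : s - o = (s - p) + (p - o) := by abel
      simp only [SetLike.mem_coe]
      rw [this]
      exact Submodule.add_mem_sup (vsub_mem_vectorSpan ℝ hs hp)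
        (Submodule.mem_span_singleton_self _)
    · rw [sup_le_iff]
      constructor
      · rw [vectorSpan_eq_span_vsub_set_right ℝ hp, Submodule.span_le]
        rintro _ ⟨s, hs, rfl⟩
        have : s - p = (s - o) - (p - o) := by abel
        simp only [vsub_eq_sub, SetLike.mem_coe]
        rw [this]
        exact Submodule.sub_mem _ (Submodule.subset_span ⟨s, hs, rfl⟩)
          (Submodule.subset_span ⟨p, hp, rfl⟩)
      · rw [Submodule.span_singleton_le_iff_mem]
        exact Submodule.subset_span ⟨p, hp, rfl⟩
  have hinf : vectorSpan ℝ S ⊓ Submodule.span ℝ {p - o} = ⊥ := by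
    rw [eq_bot_iff]
    rintro w ⟨h1, h2⟩
    obtain ⟨r, rfl⟩ := Submodule.mem_span_singleton.1 h2
    have := hker h1
    rw [LinearMap.mem_ker, map_smul, hb p hp, smul_eq_mul, mul_one] at this
    rw [this, zero_smul]
    exact Submodule.zero_mem _
  have h1 := Submodule.finrank_sup_add_finrank_inf_eq (vectorSpan ℝ S) (Submodule.span ℝ {p - o})
  have hpo : p - o ≠ 0 := by
    intro h0
    have := hb p hp
    rw [h0, map_zero] at this
    exact zero_ne_one this
  rw [hinf, finrank_bot, finrank_span_singleton hpo] at h1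
  rw [e]
  omega

/-- `o` is an admissible base point -/
def Good (V : Finset (Fin d → ℝ)) (o : Fin d → ℝ) : Prop :=
  ∀ e : Module.Dual ℝ (Fin d → ℝ), e ≠ 0 → ∃ v ∈ V, e (v - o) < 0

theorem normalize {V : Finset (Fin d → ℝ)} {o : Fin d → ℝ} (ho : Good V o)
    {b : Module.Dual ℝ (Fin d → ℝ)} {c : ℝ} (hb : b ≠ 0) (h : ∀ v ∈ V, b v ≤ c) :
    ∃ a : Module.Dual ℝ (Fin d → ℝ), (∀ v ∈ V, a (v - o) ≤ 1) ∧
      Tset V (fun v => v - o) a = Fs V b c := by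
  have hc : 0 < c - b o := by
    obtain ⟨v, hv, h1⟩ := ho (-b) (neg_ne_zero.2 hb)
    have := h v hv
    rw [LinearMap.neg_apply, map_sub] at h1
    linarith
  refine ⟨(c - b o)⁻¹ • b, ?_, ?_⟩
  · intro v hv
    rw [LinearMap.smul_apply, smul_eq_mul, map_sub, inv_mul_le_iff₀ hc]
    linarith [h v hv]
  · ext v
    rw [mem_Tset, mem_Fs, LinearMap.smul_apply, smul_eq_mul, map_sub, inv_mul_eq_one₀ hc.ne']
    constructor
    · rintro ⟨h1, h2⟩; exact ⟨h1, by linarith⟩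
    · rintro ⟨h1, h2⟩; exact ⟨h1, by linarith⟩

theorem Tset_eq_Fs (V : Finset (Fin d → ℝ)) (o : Fin d → ℝ) (a : Module.Dual ℝ (Fin d → ℝ)) :
    Tset V (fun v => v - o) a = Fs V a (1 + a o) := by
  ext v
  rw [mem_Tset, mem_Fs, map_sub]
  constructor
  · rintro ⟨h1, h2⟩; exact ⟨h1, by linarith⟩
  · rintro ⟨h1, h2⟩; exact ⟨h1, by linarith⟩

theorem rank_T {V : Finset (Fin d → ℝ)} {o : Fin d → ℝ} {a : Module.Dual ℝ (Fin d → ℝ)}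
    {S : Finset (Fin d → ℝ)} (hS : S ⊆ Tset V (fun v => v - o) a) (hne : S.Nonempty) :
    Module.finrank ℝ (Submodule.span ℝ ((fun s => s - o) '' (S : Set (Fin d → ℝ))))
      = Module.finrank ℝ (vectorSpan ℝ (S : Set (Fin d → ℝ))) + 1 :=
  finrank_span_sub o _ hne a (fun s hs => (mem_Tset.1 (hS hs)).2)

theorem facet_iff {P : Set (Fin d → ℝ)} {V : Finset (Fin d → ℝ)} (hd : 1 ≤ d)
    (hV : (V : Set (Fin d → ℝ)) = verts P) (hP : P = convexHull ℝ (V : Set (Fin d → ℝ)))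
    (hdim : polyDim P = d) {o : Fin d → ℝ} (ho : Good V o) (G : Finset (Fin d → ℝ)) :
    (G ⊆ V ∧ IsFacetOf P (convexHull ℝ (G : Set (Fin d → ℝ)))) ↔
      ∃ a, IsA V (fun v => v - o) a ∧ Tset V (fun v => v - o) a = G := by
  constructor
  · rintro ⟨hGV, hf, hne, hpd⟩
    have hGP : convexHull ℝ (G : Set (Fin d → ℝ)) ≠ P := by
      intro h; rw [h] at hpd; omega
    rw [hP] at hf hGP
    obtain ⟨b, c, hb, hle, hG⟩ := of_isFace hf hne hGP
    have hGe : G = Fs V b c :=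
      hull_inj hV hP hGV (fun v hv => (mem_Fs.1 hv).1) hG
    obtain ⟨a, h1, h2⟩ := normalize ho hb hle
    refine ⟨a, ⟨h1, ?_⟩, by rw [h2, hGe]⟩
    apply Submodule.eq_top_of_finrank_eq
    rw [convexHull_nonempty_iff, coe_nonempty] at hne
    rw [h2, ← hGe, rank_T (V := V) (a := a) (by rw [h2, hGe]) hne]
    rw [polyDim_hull] at hpd
    rw [hpd, Module.finrank_fin_fun]
    omega
  · rintro ⟨a, ha, rfl⟩
    have hne : (Tset V (fun v => v - o) a).Nonempty := by
      rw [nonempty_iff_ne_empty]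
      intro h
      have := ha.span
      rw [h] at this
      simp only [coe_empty, Set.image_empty, Submodule.span_empty] at this
      have h2 : Module.finrank ℝ (⊥ : Submodule ℝ (Fin d → ℝ))
        = Module.finrank ℝ (⊤ : Submodule ℝ (Fin d → ℝ)) := by rw [this]
      rw [finrank_bot, finrank_top, Module.finrank_fin_fun] at h2
      omega
    refine ⟨fun v hv => (mem_Tset.1 hv).1, ?_, ?_, ?_⟩
    · rw [hP, Tset_eq_Fs]
      apply isFace_of
      · intro v hv
        have := ha.le v hv
        rw [map_sub] at this
        linarith
      · rintro rfl
        obtain ⟨v, hv⟩ := hne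
        simpa using (mem_Tset.1 hv).2
    · rw [convexHull_nonempty_iff, coe_nonempty]
      exact hne
    · have := rank_T (V := V) (a := a) (subset_rfl) hne
      rw [ha.span, finrank_top, Module.finrank_fin_fun] at this
      rw [polyDim_hull]
      omega

end geom
section core2

variable {E : Type*} [AddCommGroup E] [Module ℝ E] [FiniteDimensional ℝ E]
variable {ι : Type*} [DecidableEq ι]

theorem Core.supp {V : Finset ι} {x : ι → E} {aF : Module.Dual ℝ E}
    {𝓕 𝓟 : Finset (Finset ι)} (C : Core V x aF 𝓕 𝓟) (σ : Finset ι) (hσ : σ ∈ 𝓟) :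
    ∃ b : Module.Dual ℝ E, (∀ i ∈ V, b (x i) ≤ 1) ∧ Tset V x b = σ := by
  obtain ⟨G, hG, hσG⟩ := (C.memP σ).1 hσ
  obtain ⟨a, ha, hne, rfl⟩ := (C.memF G).1 hG
  have hS := C.simp a ha hne
  have key : ∀ v, ∃ a' : Module.Dual ℝ E, IsA V x a' ∧ σ ⊆ Tset V x a' ∧
      (v ∈ Tset V x a → v ∉ σ → v ∉ Tset V x a') := by
    intro v
    by_cases hv : v ∈ Tset V x a ∧ v ∉ σ
    · obtain ⟨a', t, _, h1, _, h3, h4⟩ := hS.nb C.neg v hv.1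
      exact ⟨a', h1, fun w hw => h4 w (hσG hw) (fun h => hv.2 (h ▸ hw)), fun _ _ => h3⟩
    · exact ⟨a, ha, hσG, fun h1 h2 => absurd ⟨h1, h2⟩ hv⟩
  choose A hA1 hA2 hA3 using key
  set T := Tset V x a with hT
  have hN : (0 : ℝ) < 1 + (T.card : ℝ) := by positivity
  have hle : ∀ i ∈ V, ∑ v ∈ T, A v (x i) ≤ (T.card : ℝ) := by
    intro i hi
    calc ∑ v ∈ T, A v (x i) ≤ ∑ v ∈ T, (1 : ℝ) := sum_le_sum (fun v _ => (hA1 v).le i hi)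
      _ = (T.card : ℝ) := by simp
  refine ⟨(1 + (T.card : ℝ))⁻¹ • (a + ∑ v ∈ T, A v), ?_, ?_⟩
  · intro i hi
    rw [LinearMap.smul_apply, smul_eq_mul, LinearMap.add_apply, LinearMap.sum_apply,
      inv_mul_le_iff₀ hN]
    linarith [hle i hi, ha.le i hi]
  · ext i
    rw [mem_Tset, LinearMap.smul_apply, smul_eq_mul, LinearMap.add_apply, LinearMap.sum_apply,
      inv_mul_eq_one₀ hN.ne']
    constructor
    · rintro ⟨hi, h⟩
      have h1 := hle i hi
      have h2 := ha.le i hi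
      have h3 : i ∈ T := by
        rw [hT]
        exact mem_Tset.2 ⟨hi, by linarith⟩
      have h4 : ∑ v ∈ T, (1 - A v (x i)) = 0 := by
        rw [sum_sub_distrib]
        simp only [sum_const, nsmul_eq_mul, mul_one]
        linarith
      rw [sum_eq_zero_iff_of_nonneg (fun v _ => by linarith [(hA1 v).le i hi])] at h4
      by_contra hns
      exact hA3 i h3 hns (mem_Tset.2 ⟨hi, by linarith [h4 i h3]⟩)
    · intro hi
      have h1 := mem_Tset.1 (hσG hi)
      refine ⟨h1.1, ?_⟩
      rw [h1.2, sum_congr rfl (fun v _ => (mem_Tset.1 (hA2 v hi)).2)]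
      simp

theorem Core.small {V : Finset ι} {x : ι → E} {aF : Module.Dual ℝ E}
    {𝓕 𝓟 : Finset (Finset ι)} (C : Core V x aF 𝓕 𝓟) (b : Module.Dual ℝ E)
    (hb : ∀ i ∈ V, b (x i) ≤ 1)
    (hne : Submodule.span ℝ (x '' (Tset V x b : Set ι)) ≠ ⊤) : Tset V x b ∈ 𝓟 := by
  obtain ⟨a, h1, h2, h3⟩ := exists_other C.neg b aF hb C.isF hne
  exact (C.memP _).2 ⟨_, (C.memF _).2 ⟨a, h1, h2, rfl⟩, h3⟩

theorem Core.rank {V : Finset ι} {x : ι → E} {aF : Module.Dual ℝ E}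
    {𝓕 𝓟 : Finset (Finset ι)} (C : Core V x aF 𝓕 𝓟)
    (hc : ∀ G ∈ 𝓕, G.card = Module.finrank ℝ E) (σ : Finset ι) (hσ : σ ∈ 𝓟) :
    Module.finrank ℝ (Submodule.span ℝ (x '' (σ : Set ι))) = σ.card := by
  obtain ⟨G, hG, hσG⟩ := (C.memP σ).1 hσ
  obtain ⟨a, ha, hne, rfl⟩ := (C.memF G).1 hG
  have hli : LinearIndependent ℝ (fun i : (Tset V x a) => x i) := by
    apply linearIndependent_of_top_le_span_of_card_eq_finrank
    · rw [← ha.span]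
      apply Submodule.span_mono
      rintro _ ⟨i, hi, rfl⟩
      exact ⟨⟨i, hi⟩, rfl⟩
    · simpa using hc _ hG
  have h2 : LinearIndependent ℝ (fun i : σ => x i) :=
    hli.comp (fun i : σ => ⟨i.1, hσG i.2⟩) (fun i j h => by
      apply Subtype.ext
      simpa using h)
  have h3 := finrank_span_eq_card h2
  rw [Fintype.card_coe] at h3
  rw [← h3]
  have h4 : x '' (σ : Set ι) = Set.range (fun i : σ => x i) := by
    ext y
    simp
  rw [h4]

theorem IsA.combine {V : Finset ι} {x : ι → E} {aF : Module.Dual ℝ E} (h : IsA V x aF)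
    (b : Module.Dual ℝ E) (c : ℝ) (hb : ∀ i ∈ Tset V x aF, b (x i) ≤ c) :
    ∃ a : Module.Dual ℝ E, (∀ i ∈ V, a (x i) ≤ 1) ∧
      ∀ i, i ∈ Tset V x a ↔ i ∈ Tset V x aF ∧ b (x i) = c := by
  obtain ⟨N, hN0, hN⟩ : ∃ N : ℝ, 0 < c + N ∧
      ∀ i ∈ V, i ∉ Tset V x aF → b (x i) + N * aF (x i) < c + N := by
    refine ⟨1 + |c| + ∑ i ∈ V, |b (x i) - c| / (1 - aF (x i)), ?_, ?_⟩
    · have : 0 ≤ ∑ i ∈ V, |b (x i) - c| / (1 - aF (x i)) :=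
        sum_nonneg (fun i hi => div_nonneg (abs_nonneg _) (by linarith [h.le i hi]))
      linarith [neg_abs_le c]
    · intro i hi hn
      have hlt : 0 < 1 - aF (x i) := by
        have := lt_of_le_of_ne (h.le i hi) (fun h1 => hn (mem_Tset.2 ⟨hi, h1⟩))
        linarith
      have h1 : |b (x i) - c| / (1 - aF (x i)) ≤ ∑ i ∈ V, |b (x i) - c| / (1 - aF (x i)) :=
        single_le_sum (f := fun i => |b (x i) - c| / (1 - aF (x i)))
          (fun i hi => div_nonneg (abs_nonneg _) (by linarith [h.le i hi])) hi
      rw [div_le_iff₀ hlt] at h1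
      have h2 := le_abs_self (b (x i) - c)
      have h3 : 0 < (1 + |c|) * (1 - aF (x i)) := mul_pos (by positivity) hlt
      nlinarith
  have hle : ∀ i ∈ V, b (x i) + N * aF (x i) ≤ c + N := by
    intro i hi
    by_cases hT : i ∈ Tset V x aF
    · have := hb i hT
      rw [(mem_Tset.1 hT).2]
      linarith
    · exact (hN i hi hT).le
  refine ⟨(c + N)⁻¹ • (b + N • aF), ?_, ?_⟩
  · intro i hi
    rw [LinearMap.smul_apply, smul_eq_mul, LinearMap.add_apply, LinearMap.smul_apply,
      smul_eq_mul, inv_mul_le_iff₀ hN0]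
    linarith [hle i hi]
  · intro i
    rw [mem_Tset (a := (c + N)⁻¹ • (b + N • aF)), LinearMap.smul_apply, smul_eq_mul,
      LinearMap.add_apply, LinearMap.smul_apply, smul_eq_mul, inv_mul_eq_one₀ hN0.ne']
    constructor
    · rintro ⟨hi, he⟩
      have hT : i ∈ Tset V x aF := by
        by_contra hT
        linarith [hN i hi hT]
      refine ⟨hT, ?_⟩
      rw [(mem_Tset.1 hT).2] at he
      linarith
    · rintro ⟨hT, he⟩
      refine ⟨(mem_Tset.1 hT).1, ?_⟩
      rw [(mem_Tset.1 hT).2]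
      linarith

end core2

section data

variable {d : ℕ}

structure Data (P F : Set (Fin d → ℝ)) (V VF : Finset (Fin d → ℝ)) : Prop where
  hd : 1 ≤ d
  hV : (V : Set (Fin d → ℝ)) = verts P
  hP : P = convexHull ℝ (V : Set (Fin d → ℝ))
  hdim : polyDim P = d
  hVF : VF ⊆ V
  hF : F = convexHull ℝ (VF : Set (Fin d → ℝ))
  fac : IsFacetOf P F
  simp : ∀ G, IsFacetOf P G → G ≠ F → (verts G).ncard = d

open Classical in
def FF (P F : Set (Fin d → ℝ)) (V : Finset (Fin d → ℝ)) : Finset (Finset (Fin d → ℝ)) :=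
  V.powerset.filter (fun T => IsFacetOf P (convexHull ℝ (T : Set (Fin d → ℝ))) ∧
    convexHull ℝ (T : Set (Fin d → ℝ)) ≠ F)

theorem mem_FF {P F : Set (Fin d → ℝ)} {V T : Finset (Fin d → ℝ)} :
    T ∈ FF P F V ↔ T ⊆ V ∧ IsFacetOf P (convexHull ℝ (T : Set (Fin d → ℝ))) ∧
    convexHull ℝ (T : Set (Fin d → ℝ)) ≠ F := by
  unfold FF
  simp only [mem_filter, mem_powerset]

def PP (P F : Set (Fin d → ℝ)) (V : Finset (Fin d → ℝ)) : Finset (Finset (Fin d → ℝ)) :=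
  (FF P F V).biUnion powerset

theorem mem_PP {P F : Set (Fin d → ℝ)} {V T : Finset (Fin d → ℝ)} :
    T ∈ PP P F V ↔ ∃ G ∈ FF P F V, T ⊆ G := by
  unfold PP
  simp only [mem_biUnion, mem_powerset]

variable {P F : Set (Fin d → ℝ)} {V VF : Finset (Fin d → ℝ)}

theorem Data.VFne (D : Data P F V VF) : VF.Nonempty := by
  have := D.fac.2.1
  rw [D.hF, convexHull_nonempty_iff, coe_nonempty] at this
  exact this

theorem Data.cardFF (D : Data P F V VF) : ∀ G ∈ FF P F V, G.card = d := by
  intro G hG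
  obtain ⟨h1, h2, h3⟩ := mem_FF.1 hG
  have := D.simp _ h2 h3
  rwa [verts_hull D.hV D.hP h1, Set.ncard_coe_finset] at this

theorem Data.core (D : Data P F V VF) {o : Fin d → ℝ} (ho : Good V o) :
    ∃ aF, Core V (fun v => v - o) aF (FF P F V) (PP P F V) ∧
      Tset V (fun v => v - o) aF = VF := by
  have hi := facet_iff D.hd D.hV D.hP D.hdim ho
  have hfac := D.fac
  rw [D.hF] at hfac
  obtain ⟨aF, hA, hT⟩ := (hi VF).1 ⟨D.hVF, hfac⟩
  have memF : ∀ G, G ∈ FF P F V ↔ ∃ a, IsA V (fun v => v - o) a ∧ a ≠ aF ∧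
      Tset V (fun v => v - o) a = G := by
    intro G
    rw [mem_FF]
    constructor
    · rintro ⟨h1, h2, h3⟩
      obtain ⟨a, ha, haT⟩ := (hi G).1 ⟨h1, h2⟩
      refine ⟨a, ha, ?_, haT⟩
      rintro rfl
      rw [hT] at haT
      rw [← haT] at h3
      exact h3 D.hF.symm
    · rintro ⟨a, ha, hne, rfl⟩
      obtain ⟨h1, h2⟩ := (hi _).2 ⟨a, ha, rfl⟩
      refine ⟨h1, h2, ?_⟩
      intro h
      rw [D.hF] at h
      have := hull_inj D.hV D.hP h1 D.hVF h
      exact hne (ha.eq_of_subset (by rw [this, hT]))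
  refine ⟨aF, ⟨ho, hA, ?_, memF, fun σ => mem_PP⟩, hT⟩
  intro a ha hne
  have hc := D.cardFF _ ((memF _).2 ⟨a, ha, hne, rfl⟩)
  refine ⟨ha, fun v hv => dc_spec (exists_isDual ha.span ?_ v hv)⟩
  rw [hc, Module.finrank_fin_fun]

theorem Data.good (D : Data P F V VF) {v : Fin d → ℝ} (hv : v ∈ V) (hvF : v ∉ VF) :
    ∃ o, Good V o ∧ v - o = - ∑ w ∈ VF, (w - o) := by
  set m : ℝ := (VF.card : ℝ) + 1 with hm
  have hm0 : m ≠ 0 := by positivity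
  set o : Fin d → ℝ := m⁻¹ • (∑ w ∈ VF, w + v) with ho
  have hmo : m • o = ∑ w ∈ VF, w + v := by
    rw [ho, smul_inv_smul₀ hm0]
  have hsum : v - o = - ∑ w ∈ VF, (w - o) := by
    rw [sum_sub_distrib, sum_const, ← Nat.cast_smul_eq_nsmul ℝ]
    have : m • o = (VF.card : ℝ) • o + o := by rw [hm, add_smul, one_smul]
    rw [this] at hmo
    have h2 : ∑ w ∈ VF, w = (VF.card : ℝ) • o + o - v := by rw [hmo]; abel
    rw [h2]
    abel
  refine ⟨o, ?_, hsum⟩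
  intro e he
  by_contra! hcon
  have h1 : ∑ w ∈ VF, e (w - o) + e (v - o) = 0 := by
    rw [hsum, map_neg, map_sum]
    ring
  have h2 : 0 ≤ ∑ w ∈ VF, e (w - o) := sum_nonneg (fun w hw => hcon w (D.hVF hw))
  have h3 := hcon v hv
  have h4 : ∑ w ∈ VF, e (w - o) = 0 := by linarith
  rw [sum_eq_zero_iff_of_nonneg (fun w hw => hcon w (D.hVF hw))] at h4
  have h5 : e v = e o := by
    have : e (v - o) = 0 := by linarith
    rw [map_sub] at this
    linarith
  have h6 : ∀ w ∈ VF, e w = e o := by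
    intro w hw
    have := h4 w hw
    rw [map_sub] at this
    linarith
  obtain ⟨w0, hw0⟩ := D.VFne
  obtain ⟨hf, hne, hpd⟩ := D.fac
  have hFP : F ≠ P := by
    intro h
    rw [h, D.hdim] at hpd
    have := D.hd
    omega
  rw [D.hP] at hf hFP
  obtain ⟨b, c, hb, hle, hG⟩ := of_isFace hf hne hFP
  rw [D.hF] at hG
  have hVFe : VF = Fs V b c := hull_inj D.hV D.hP D.hVF (fun v hv => (mem_Fs.1 hv).1) hG
  have hbv : b v ≠ c := fun h => hvF (by rw [hVFe]; exact mem_Fs.2 ⟨hv, h⟩)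
  have hbF : ∀ w ∈ VF, b w = c := by
    intro w hw
    rw [hVFe] at hw
    exact (mem_Fs.1 hw).2
  have ker : ∀ (g : Module.Dual ℝ (Fin d → ℝ)) (r : ℝ), (∀ w ∈ VF, g w = r) →
      vectorSpan ℝ (VF : Set (Fin d → ℝ)) ≤ LinearMap.ker g := by
    intro g r hg
    rw [vectorSpan_eq_span_vsub_set_right ℝ (mem_coe.2 hw0), Submodule.span_le]
    rintro _ ⟨s, hs, rfl⟩
    simp only [vsub_eq_sub, SetLike.mem_coe, LinearMap.mem_ker, map_sub]
    rw [hg s hs, hg w0 hw0, sub_self]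
  have hlt : vectorSpan ℝ (VF : Set (Fin d → ℝ)) <
      vectorSpan ℝ (VF : Set (Fin d → ℝ)) ⊔ Submodule.span ℝ {v - w0} := by
    refine lt_of_le_of_ne le_sup_left ?_
    intro h
    have : v - w0 ∈ vectorSpan ℝ (VF : Set (Fin d → ℝ)) := by
      rw [h]
      exact Submodule.mem_sup_right (Submodule.mem_span_singleton_self _)
    have := ker b c hbF this
    rw [LinearMap.mem_ker, map_sub, hbF w0 hw0] at this
    exact hbv (by linarith)
  have hfr := Submodule.finrank_lt_finrank_of_lt hlt
  rw [D.hF, polyDim_hull] at hpd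
  rw [hpd] at hfr
  have htop : vectorSpan ℝ (VF : Set (Fin d → ℝ)) ⊔ Submodule.span ℝ {v - w0} = ⊤ := by
    apply Submodule.eq_top_of_finrank_eq
    have := Submodule.finrank_le
      (vectorSpan ℝ (VF : Set (Fin d → ℝ)) ⊔ Submodule.span ℝ {v - w0})
    rw [Module.finrank_fin_fun] at this ⊢
    omega
  have hk : (⊤ : Submodule ℝ (Fin d → ℝ)) ≤ LinearMap.ker e := by
    rw [← htop, sup_le_iff, Submodule.span_singleton_le_iff_mem]
    refine ⟨ker e _ h6, ?_⟩
    rw [LinearMap.mem_ker, map_sub, h5, h6 w0 hw0, sub_self]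
  apply he
  refine LinearMap.ext (fun y => ?_)
  exact hk Submodule.mem_top

theorem Data.exists_core (D : Data P F V VF) :
    ∃ o aF, Good V o ∧ Core V (fun v => v - o) aF (FF P F V) (PP P F V) ∧
      Tset V (fun v => v - o) aF = VF := by
  have : ∃ v ∈ V, v ∉ VF := by
    by_contra! h
    have h1 : VF = V := Subset.antisymm D.hVF h
    have h2 := D.fac.2.2
    rw [D.hF, h1, ← D.hP, D.hdim] at h2
    have := D.hd
    omega
  obtain ⟨v, hv, hvF⟩ := this
  obtain ⟨o, ho, -⟩ := D.good hv hvF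
  obtain ⟨aF, h1, h2⟩ := D.core ho
  exact ⟨o, aF, ho, h1, h2⟩

end data
section counts

variable {d : ℕ} {P F : Set (Fin d → ℝ)} {V VF : Finset (Fin d → ℝ)}

theorem PP_sub {σ : Finset (Fin d → ℝ)} (h : σ ∈ PP P F V) : σ ⊆ V := by
  obtain ⟨G, hG, hs⟩ := mem_PP.1 h
  exact hs.trans (mem_FF.1 hG).1

theorem Data.dimP (D : Data P F V VF) {σ : Finset (Fin d → ℝ)} (h : σ ∈ PP P F V)
    (hne : σ.Nonempty) :
    Module.finrank ℝ (vectorSpan ℝ (σ : Set (Fin d → ℝ))) + 1 = σ.card := by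
  obtain ⟨o, aF, ho, C, hT⟩ := D.exists_core
  obtain ⟨G, hG, hs⟩ := (C.memP σ).1 h
  obtain ⟨a, ha, -, rfl⟩ := (C.memF G).1 hG
  rw [← rank_T hs hne]
  exact C.rank (by rw [Module.finrank_fin_fun]; exact D.cardFF) σ h

theorem Data.suppP (D : Data P F V VF) {σ : Finset (Fin d → ℝ)} (h : σ ∈ PP P F V)
    (hne : σ.Nonempty) :
    ∃ (b : Module.Dual ℝ (Fin d → ℝ)) (c : ℝ), b ≠ 0 ∧ (∀ v ∈ V, b v ≤ c) ∧ Fs V b c = σ := by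
  obtain ⟨o, aF, ho, C, hT⟩ := D.exists_core
  obtain ⟨b, hb, hbT⟩ := C.supp σ h
  refine ⟨b, 1 + b o, ?_, ?_, ?_⟩
  · rintro rfl
    obtain ⟨v, hv⟩ := hne
    rw [← hbT] at hv
    simpa using (mem_Tset.1 hv).2
  · intro v hv
    have := hb v hv
    rw [map_sub] at this
    linarith
  · rw [← Tset_eq_Fs, hbT]

theorem small_span {o : Fin d → ℝ} {b : Module.Dual ℝ (Fin d → ℝ)}
    (hne : (Tset V (fun v => v - o) b).Nonempty)
    (hr : Module.finrank ℝ (vectorSpan ℝ (Tset V (fun v => v - o) b : Set (Fin d → ℝ))) + 1 < d) :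
    Submodule.span ℝ ((fun v => v - o) '' (Tset V (fun v => v - o) b : Set (Fin d → ℝ))) ≠ ⊤ := by
  intro h
  have := rank_T (V := V) (a := b) subset_rfl hne
  rw [h, finrank_top, Module.finrank_fin_fun] at this
  omega

theorem Data.smallP (D : Data P F V VF) {b : Module.Dual ℝ (Fin d → ℝ)} {c : ℝ} (hb : b ≠ 0)
    (hle : ∀ v ∈ V, b v ≤ c) (hne : (Fs V b c).Nonempty)
    (hr : Module.finrank ℝ (vectorSpan ℝ (Fs V b c : Set (Fin d → ℝ))) + 1 < d) :
    Fs V b c ∈ PP P F V := by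
  obtain ⟨o, aF, ho, C, hT⟩ := D.exists_core
  obtain ⟨a, h1, h2⟩ := normalize ho hb hle
  rw [← h2] at hne hr ⊢
  exact C.small a h1 (small_span hne hr)

theorem Data.smallF (D : Data P F V VF) {b : Module.Dual ℝ (Fin d → ℝ)} {c : ℝ}
    (hle : ∀ v ∈ VF, b v ≤ c) (hne : (Fs VF b c).Nonempty)
    (hr : Module.finrank ℝ (vectorSpan ℝ (Fs VF b c : Set (Fin d → ℝ))) + 1 < d) :
    Fs VF b c ∈ PP P F V := by
  obtain ⟨o, aF, ho, C, hT⟩ := D.exists_core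
  obtain ⟨a, h1, h2⟩ := C.isF.combine b (c - b o) (by
    intro v hv
    rw [hT] at hv
    have := hle v hv
    rw [map_sub]
    linarith)
  have h3 : Tset V (fun v => v - o) a = Fs VF b c := by
    ext v
    rw [h2, hT, mem_Fs, map_sub]
    constructor
    · rintro ⟨h1, h2⟩; exact ⟨h1, by linarith⟩
    · rintro ⟨h1, h2⟩; exact ⟨h1, by linarith⟩
  rw [← h3] at hne hr ⊢
  exact C.small a h1 (small_span hne hr)

theorem Data.face_iff (D : Data P F V VF) {i : ℕ} (h1 : 1 ≤ i) (hi : i < d)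
    (S : Set (Fin d → ℝ)) :
    (IsFaceOf P S ∧ S.Nonempty ∧ polyDim S = i - 1) ↔
      ∃ σ ∈ (PP P F V).filter (fun σ => σ.card = i), convexHull ℝ (σ : Set (Fin d → ℝ)) = S := by
  constructor
  · rintro ⟨hf, hne, hpd⟩
    have hSP : S ≠ P := by
      rintro rfl
      rw [D.hdim] at hpd
      omega
    rw [D.hP] at hf hSP
    obtain ⟨b, c, hb, hle, rfl⟩ := of_isFace hf hne hSP
    rw [convexHull_nonempty_iff, coe_nonempty] at hne
    rw [polyDim_hull] at hpd
    have hm := D.smallP hb hle hne (by omega)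
    have := D.dimP hm hne
    exact ⟨_, mem_filter.2 ⟨hm, by omega⟩, rfl⟩
  · rintro ⟨σ, hσ, rfl⟩
    obtain ⟨hσ, hc⟩ := mem_filter.1 hσ
    have hne : σ.Nonempty := by
      rw [← card_pos]
      omega
    obtain ⟨b, c, hb, hle, he⟩ := D.suppP hσ hne
    refine ⟨?_, ?_, ?_⟩
    · rw [← he, D.hP]
      exact isFace_of hle hb
    · rwa [convexHull_nonempty_iff, coe_nonempty]
    · rw [polyDim_hull]
      have := D.dimP hσ hne
      omega

theorem Data.face_iffF (D : Data P F V VF) {i : ℕ} (h1 : 1 ≤ i) (hi : i < d)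
    (S : Set (Fin d → ℝ)) :
    (IsFaceOf F S ∧ S.Nonempty ∧ polyDim S = i - 1) ↔
      ∃ σ ∈ (PP P F V).filter (fun σ => σ ⊆ VF ∧ σ.card = i),
        convexHull ℝ (σ : Set (Fin d → ℝ)) = S := by
  constructor
  · rintro ⟨hf, hne, hpd⟩
    have hSP : S ≠ F := by
      rintro rfl
      rw [D.fac.2.2] at hpd
      omega
    rw [D.hF] at hf hSP
    obtain ⟨b, c, hb, hle, rfl⟩ := of_isFace hf hne hSP
    rw [convexHull_nonempty_iff, coe_nonempty] at hne
    rw [polyDim_hull] at hpd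
    have hm := D.smallF hle hne (by omega)
    have := D.dimP hm hne
    exact ⟨_, mem_filter.2 ⟨hm, fun v hv => (mem_Fs.1 hv).1, by omega⟩, rfl⟩
  · rintro ⟨σ, hσ, rfl⟩
    obtain ⟨hσ, hs, hc⟩ := mem_filter.1 hσ
    have hne : σ.Nonempty := by
      rw [← card_pos]
      omega
    obtain ⟨b, c, hb, hle, he⟩ := D.suppP hσ hne
    have he' : Fs VF b c = σ := by
      apply Subset.antisymm
      · intro v hv
        rw [← he]
        exact mem_Fs.2 ⟨D.hVF (mem_Fs.1 hv).1, (mem_Fs.1 hv).2⟩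
      · intro v hv
        refine mem_Fs.2 ⟨hs hv, ?_⟩
        rw [← he] at hv
        exact (mem_Fs.1 hv).2
    refine ⟨?_, ?_, ?_⟩
    · rw [← he', D.hF]
      exact isFace_of (fun v hv => hle v (D.hVF hv)) hb
    · rwa [convexHull_nonempty_iff, coe_nonempty]
    · rw [polyDim_hull]
      have := D.dimP hσ hne
      omega

theorem Data.ncard_hull (D : Data P F V VF) (𝓢 : Finset (Finset (Fin d → ℝ)))
    (h : ∀ σ ∈ 𝓢, σ ⊆ V) :
    ((fun σ : Finset (Fin d → ℝ) => convexHull ℝ (σ : Set (Fin d → ℝ))) ''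
      (𝓢 : Set (Finset (Fin d → ℝ)))).ncard = 𝓢.card := by
  rw [Set.InjOn.ncard_image, Set.ncard_coe_finset]
  intro σ hσ τ hτ he
  exact hull_inj D.hV D.hP (h σ hσ) (h τ hτ) he

theorem Data.fVecP (D : Data P F V VF) {i : ℕ} (h1 : 1 ≤ i) (hi : i < d) :
    fVec P (i - 1) = ((PP P F V).filter (fun σ => σ.card = i)).card := by
  rw [← D.ncard_hull _ (fun σ hσ => PP_sub (mem_filter.1 hσ).1)]
  unfold fVec
  congr 1
  ext S
  exact D.face_iff h1 hi S

theorem Data.fVecF (D : Data P F V VF) {i : ℕ} (h1 : 1 ≤ i) (hi : i < d) :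
    fVec F (i - 1) = ((PP P F V).filter (fun σ => σ ⊆ VF ∧ σ.card = i)).card := by
  rw [← D.ncard_hull _ (fun σ hσ => PP_sub (mem_filter.1 hσ).1)]
  unfold fVec
  congr 1
  ext S
  exact D.face_iffF h1 hi S

theorem Data.filter_d (D : Data P F V VF) :
    (PP P F V).filter (fun σ => σ.card = d) = FF P F V := by
  ext σ
  rw [mem_filter, mem_PP]
  constructor
  · rintro ⟨⟨G, hG, hs⟩, hc⟩
    rwa [eq_of_subset_of_card_le hs (by rw [hc, D.cardFF G hG])]
  · intro h
    exact ⟨⟨σ, h, subset_rfl⟩, D.cardFF σ h⟩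

theorem Data.fVec_top (D : Data P F V VF) :
    fVec P (d - 1) = (FF P F V).card + 1 := by
  have hsub : ∀ σ ∈ FF P F V, σ ⊆ V := fun σ hσ => (mem_FF.1 hσ).1
  rw [← D.ncard_hull _ hsub]
  rw [← Set.ncard_insert_of_notMem (a := F)]
  · unfold fVec
    congr 1
    ext S
    constructor
    · rintro ⟨hf, hne, hpd⟩
      by_cases hSF : S = F
      · exact Or.inl hSF
      right
      have hfac : IsFacetOf P S := ⟨hf, hne, hpd⟩
      have hSP : S ≠ P := by
        rintro rfl
        rw [D.hdim] at hpd
        have := D.hd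
        omega
      rw [D.hP] at hf hSP
      obtain ⟨b, c, hb, hle, rfl⟩ := of_isFace hf hne hSP
      exact ⟨_, mem_FF.2 ⟨fun v hv => (mem_Fs.1 hv).1, hfac, hSF⟩, rfl⟩
    · rintro (rfl | ⟨σ, hσ, rfl⟩)
      · exact D.fac
      · exact (mem_FF.1 hσ).2.1
  · rintro ⟨σ, hσ, he⟩
    exact (mem_FF.1 hσ).2.2 he

theorem Data.empty_mem (D : Data P F V VF) : ∅ ∈ PP P F V := by
  obtain ⟨o, aF, ho, C, hT⟩ := D.exists_core
  have h0 : Tset V (fun v => v - o) 0 = ∅ := by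
    ext v
    simp [mem_Tset]
  rw [← h0]
  apply C.small 0 (by intro v hv; simp)
  rw [h0]
  intro h
  simp only [coe_empty, Set.image_empty, Submodule.span_empty] at h
  have h2 : Module.finrank ℝ (⊥ : Submodule ℝ (Fin d → ℝ))
    = Module.finrank ℝ (⊤ : Submodule ℝ (Fin d → ℝ)) := by rw [h]
  rw [finrank_bot, finrank_top, Module.finrank_fin_fun] at h2
  have := D.hd
  omega

theorem Data.fBall_eq (D : Data P F V VF) {i : ℕ} (hi : i ≤ d) :
    fBall P i = (((PP P F V).filter (fun σ => σ.card = i)).card : ℤ) := by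
  have hd := D.hd
  unfold fBall
  split_ifs with h1 h2 h3
  · subst h1
    have : (PP P F V).filter (fun σ => σ.card = 0) = {∅} := by
      ext σ
      rw [mem_filter, card_eq_zero, mem_singleton]
      constructor
      · exact fun h => h.2
      · rintro rfl
        exact ⟨D.empty_mem, rfl⟩
    rw [this]
    simp
  · subst h2
    rw [D.filter_d, D.fVec_top]
    push_cast
    ring
  · omega
  · rw [D.fVecP (by omega) (by omega)]

theorem Data.fBd_eq (D : Data P F V VF) {i : ℕ} (hi : i ≤ d) :
    fBd (d - 1) F i = (((PP P F V).filter (fun σ => σ ⊆ VF ∧ σ.card = i)).card : ℤ) := by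
  have hd := D.hd
  unfold fBd
  split_ifs with h1 h2
  · subst h1
    have : (PP P F V).filter (fun σ => σ ⊆ VF ∧ σ.card = 0) = {∅} := by
      ext σ
      rw [mem_filter, card_eq_zero, mem_singleton]
      constructor
      · exact fun h => h.2.2
      · rintro rfl
        exact ⟨D.empty_mem, empty_subset _, rfl⟩
    rw [this]
    simp
  · obtain rfl : i = d := by omega
    have : (PP P F V).filter (fun σ => σ ⊆ VF ∧ σ.card = i) = ∅ := by
      rw [filter_eq_empty_iff]
      rintro σ hσ ⟨hs, hc⟩
      have hσF : σ ∈ FF P F V := by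
        rw [← D.filter_d]
        exact mem_filter.2 ⟨hσ, hc⟩
      obtain ⟨o, aF, ho, C, hT⟩ := D.exists_core
      obtain ⟨a, ha, hne, rfl⟩ := (C.memF _).1 hσF
      exact hne (ha.eq_of_subset (by rw [hT]; exact hs))
    rw [this]
    simp
  · rw [D.fVecF (by omega) (by omega)]

theorem hOf_succ (m j : ℕ) (hj : j ≤ m) (f : ℕ → ℤ) :
    hOf (m + 1) f (j + 1) = hOf m f (j + 1) - hOf m f j := by
  unfold hOf
  rw [sum_range_succ (n := j + 1), sum_range_succ (n := j + 1)]
  have : ∑ i ∈ range (j + 1), (-1 : ℤ) ^ (j + 1 - i) * ((m + 1 - i).choose (j + 1 - i) : ℤ) * f i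
      = ∑ i ∈ range (j + 1), (-1 : ℤ) ^ (j + 1 - i) * ((m - i).choose (j + 1 - i) : ℤ) * f i
      - ∑ i ∈ range (j + 1), (-1 : ℤ) ^ (j - i) * ((m - i).choose (j - i) : ℤ) * f i := by
    rw [← sum_sub_distrib]
    apply sum_congr rfl
    intro i hi
    rw [mem_range] at hi
    have e1 : m + 1 - i = (m - i) + 1 := by omega
    have e2 : j + 1 - i = (j - i) + 1 := by omega
    rw [e1, e2, Nat.choose_succ_succ]
    push_cast
    ring
  rw [this]
  simp
  ring

theorem Data.gBd_eq (D : Data P F V VF) {k : ℕ} (hk : k ≤ d) :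
    gBd (d - 1) F (k : ℤ) =
      hOf d (fun i => (((PP P F V).filter (fun σ => σ ⊆ VF ∧ σ.card = i)).card : ℤ)) k := by
  have hd := D.hd
  rw [← hOf_congr d k (fBd (d - 1) F) _ (fun i hi => D.fBd_eq (by omega))]
  have h0 : ∀ j : ℕ, j ≤ d → hBd (d - 1) F (j : ℤ) = hOf (d - 1) (fBd (d - 1) F) j := by
    intro j hj
    unfold hBd
    split_ifs with h
    · rfl
    · obtain rfl : j = d := by omega
      unfold hOf
      symm
      apply sum_eq_zero
      intro i hi
      rw [mem_range] at hi
      by_cases hij : i = j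
      · have : fBd (j - 1) F i = 0 := by
          unfold fBd
          rw [if_neg (by omega), if_pos (by omega)]
        rw [this, mul_zero]
      · rw [Nat.choose_eq_zero_of_lt (by omega)]
        simp
  unfold gBd
  rw [h0 k hk]
  rcases k with _ | j
  · have : hBd (d - 1) F (((0 : ℕ) : ℤ) - 1) = 0 := by
      unfold hBd
      rw [if_neg (by omega)]
    rw [this]
    simp [hOf]
  · have e : (((j + 1 : ℕ) : ℤ) - 1) = (j : ℤ) := by push_cast; ring
    rw [e, h0 j (by omega)]
    have := hOf_succ (d - 1) j (by omega) (fBd (d - 1) F)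
    rw [Nat.sub_add_cancel hd] at this
    exact this.symm

theorem Data.hBall_eq (D : Data P F V VF) {k : ℕ} (hk : k ≤ d) :
    hBall P (k : ℤ) =
      hOf d (fun i => (((PP P F V).filter (fun σ => σ.card = i)).card : ℤ)) k := by
  rw [← hOf_congr d k (fBall P) _ (fun i hi => D.fBall_eq (by omega))]
  unfold hBall
  rw [if_pos (by omega)]
  rfl

theorem Data.main (D : Data P F V VF) {k : ℕ} (hk : k ≤ d) :
    ((k : ℤ) + 1) * hBall P ((d : ℤ) - ((k : ℤ) + 1))
        ≤ ((V.card : ℤ) - d + k) * hBall P ((d : ℤ) - k)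
          + ((V.card : ℤ) - VF.card) * gBd (d - 1) F (k : ℤ) := by
  have h := comb_main V VF (FF P F V) d D.hVF D.VFne D.cardFF (fun G hG => (mem_FF.1 hG).1)
    (PP P F V) (by
      intro v hv
      obtain ⟨o, aF, ho, C, hT⟩ := D.exists_core
      rw [← hT] at hv
      have := C.hA v hv
      rw [hT] at this
      exact this) (by
      intro v hv hvF
      obtain ⟨o, ho, hs⟩ := D.good hv hvF
      obtain ⟨aF, C, hT⟩ := D.core ho
      exact C.hB v hv (by rw [hT]; exact hs)) _ _ (fun _ => rfl) (fun _ => rfl) k hk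
  rw [D.gBd_eq hk]
  have e1 : (d : ℤ) - k = ((d - k : ℕ) : ℤ) := by omega
  rw [e1, D.hBall_eq (by omega)]
  have e2 : hBall P ((d : ℤ) - ((k : ℤ) + 1)) = if k + 1 ≤ d then
      hOf d (fun i => (((PP P F V).filter (fun σ => σ.card = i)).card : ℤ)) (d - (k + 1))
      else 0 := by
    split_ifs with h1
    · have e3 : (d : ℤ) - ((k : ℤ) + 1) = ((d - (k + 1) : ℕ) : ℤ) := by omega
      rw [e3, D.hBall_eq (by omega)]
    · unfold hBall
      rw [if_neg (by omega)]
  rw [e2]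
  exact h

theorem exists_Data (hd : 1 ≤ d) (h : IsASPPair P F) : ∃ V VF, Data P F V VF := by
  obtain ⟨hp, hdim, hfac, hsimp⟩ := h
  obtain ⟨V, hV, hP⟩ := exists_V hp
  have hFP : F ≠ P := by
    rintro rfl
    have := hfac.2.2
    omega
  have hf := hfac.1
  rw [hP] at hf hFP
  obtain ⟨b, c, hb, hle, hF⟩ := of_isFace hf hfac.2.1 hFP
  exact ⟨V, Fs V b c, hd, hV, hP, hdim, fun v hv => (mem_Fs.1 hv).1, hF, hfac, hsimp⟩

end counts
/-- **Key recursive h-inequality, first form.** For an ASP-pair `(P,F)` with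
`P ∈ 𝒫(d,n,s)` and `P' = ∂P − {F}`: for every `k ≥ 0`,
`(k+1)·h_{d−(k+1)}(P') ≤ (n−d+k)·h_{d−k}(P') + (n−d−s)·g_k(∂F)`. -/
theorem asp_h_recursive_ineq_first (d n s : ℕ) (P F : Set (Fin d → ℝ))
    (hPF : IsASPPair P F) (hn : (verts P).ncard = n) (hF : (verts F).ncard = d + s) :
    ∀ k : ℕ,
      ((k : ℤ) + 1) * hBall P ((d : ℤ) - ((k : ℤ) + 1))
        ≤ ((n : ℤ) - d + k) * hBall P ((d : ℤ) - k)
          + ((n : ℤ) - d - s) * gBd (d - 1) F (k : ℤ) := by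
  intro k
  rcases Nat.eq_zero_or_pos d with h0 | hd
  · subst h0
    have hsub : ∀ S : Set (Fin 0 → ℝ), S.Nonempty → S = Set.univ := by
      rintro S ⟨x, hx⟩
      ext y
      simp only [Set.mem_univ, iff_true]
      rwa [Subsingleton.elim y x]
    obtain ⟨hp, hdim, ⟨hf, hne, -⟩, -⟩ := hPF
    have hFu := hsub F hne
    have hPne : P.Nonempty := by
      rcases hf with h | h | ⟨b, c, hb, -, -⟩
      · exact absurd h hne.ne_empty
      · rw [← h]; exact hne
      · exact absurd (Subsingleton.elim b 0) hb
    have hPu := hsub P hPne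
    have hns : n = s := by
      rw [← hn, hPu, ← hFu, hF, zero_add]
    have h1 : hBall P (((0 : ℕ) : ℤ) - ((k : ℤ) + 1)) = 0 := by
      unfold hBall
      rw [if_neg (by omega)]
    rw [h1, hns]
    have h2 : (s : ℤ) - ((0 : ℕ) : ℤ) - s = 0 := by push_cast; ring
    rw [h2, mul_zero, zero_mul, add_zero]
    apply mul_nonneg
    · push_cast; omega
    · unfold hBall
      split_ifs with h
      · have : ((0 : ℕ) : ℤ) - (k : ℤ) = 0 := by omega
        rw [this]
        simp [fBall]
      · exact le_rfl
  · by_cases hk : k ≤ d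
    · obtain ⟨V, VF, D⟩ := exists_Data hd hPF
      have h := D.main hk
      have e1 : V.card = n := by
        rw [← hn, ← D.hV, Set.ncard_coe_finset]
      have e2 : VF.card = d + s := by
        rw [← hF, D.hF, verts_hull D.hV D.hP D.hVF, Set.ncard_coe_finset]
      rw [e1, e2] at h
      push_cast at h
      rw [← sub_sub (n : ℤ) (d : ℤ) (s : ℤ)] at h
      exact h
    · have h1 : hBall P ((d : ℤ) - ((k : ℤ) + 1)) = 0 := by
        unfold hBall
        rw [if_neg (by omega)]
      have h2 : hBall P ((d : ℤ) - k) = 0 := by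
        unfold hBall
        rw [if_neg (by omega)]
      have h3 : gBd (d - 1) F (k : ℤ) = 0 := by
        unfold gBd hBd
        rw [if_neg (by omega), if_neg (by omega), sub_zero]
      rw [h1, h2, h3]
      simp

end

end ASP
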